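/- arXiv:2405.16074 — 3 statements merged into one kernel-verified Lean document; each statement's English description precedes it below -/
import Mathlib

section
/- Second-order estimates with constants independent of the horizontal length: for every q ∈ [2,∞) there exists a constant C(q) > 0, and there exists a constant C > 0, both depending only on q, μ, k₀, k₁ (and not on R), such that for every R > 0 and every twice continuously differentiable vector field u = (u₁,u₂) on Ω_R satisfying ∂₁u₁ + ∂₂u₂ = 0 on Ω_R, u = 0 on the lateral sides {±R}×[0,1], and the Navier boundary conditions u₂(x₁,0) = u₂(x₁,1) = 0, ∂₂u₁(x₁,1) = (k₁/μ)·u₁(x₁,1), ∂₂u₁(x₁,0) = −(k₀/μ)·u₁(x₁,0) for all x₁ ∈ [-R,R], one has: (i) ‖∇u₂‖_{L^q(Ω_R)} ≤ C(q)·‖∇²u‖_{L²(Ω_R)}, and (ii) ‖∂₂u₁‖_{L⁴(Ω_R)} ≤ C·(‖∇²u₁‖_{L²(Ω_R)}^{1/2}·‖∇u₁‖_{L²(Ω_R)}^{1/2} + ‖∇u₁‖_{L²(Ω_R)}^{3/4}·‖∇²u₁‖_{L²(Ω_R)}^{1/4}). -/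
open MeasureTheory Set

noncomputable section

/-- first partial derivative in the horizontal direction -/
def pd1 (u : ℝ × ℝ → ℝ) (x : ℝ × ℝ) : ℝ := fderiv ℝ u x (1, 0)

/-- first partial derivative in the vertical direction -/
def pd2 (u : ℝ × ℝ → ℝ) (x : ℝ × ℝ) : ℝ := fderiv ℝ u x (0, 1)

/-- the rectangle `Ω_R = [-R,R] × [0,1]` -/
def OmegaR (R : ℝ) : Set (ℝ × ℝ) := (Icc (-R) R) ×ˢ (Icc (0 : ℝ) 1)

/-- `L^q` norm of a scalar function on a planar region -/
def lqNorm (q : ℝ) (Ω : Set (ℝ × ℝ)) (f : ℝ × ℝ → ℝ) : ℝ :=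
  (∫ x in Ω, |f x| ^ q) ^ (1 / q)

/-- `L^q` norm of a planar vector field (components `f`, `g`) -/
def lqNormVec (q : ℝ) (Ω : Set (ℝ × ℝ)) (f g : ℝ × ℝ → ℝ) : ℝ :=
  ((lqNorm q Ω f) ^ q + (lqNorm q Ω g) ^ q) ^ (1 / q)

/-- `L²` norm of the gradient of a scalar function -/
def gradL2Norm₁ (Ω : Set (ℝ × ℝ)) (u : ℝ × ℝ → ℝ) : ℝ :=
  ((lqNorm 2 Ω (pd1 u)) ^ (2 : ℝ) + (lqNorm 2 Ω (pd2 u)) ^ (2 : ℝ)) ^ ((1 : ℝ) / 2)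

/-- `L²` norm of all second-order partial derivatives of a scalar function -/
def hessL2Norm₁ (Ω : Set (ℝ × ℝ)) (u : ℝ × ℝ → ℝ) : ℝ :=
  ((lqNorm 2 Ω (pd1 (pd1 u))) ^ (2 : ℝ) + (lqNorm 2 Ω (pd1 (pd2 u))) ^ (2 : ℝ) +
    (lqNorm 2 Ω (pd2 (pd1 u))) ^ (2 : ℝ) + (lqNorm 2 Ω (pd2 (pd2 u))) ^ (2 : ℝ)) ^ ((1 : ℝ) / 2)

/-- `L²` norm of all second-order partial derivatives of a planar vector field -/
def hessL2Norm (Ω : Set (ℝ × ℝ)) (u1 u2 : ℝ × ℝ → ℝ) : ℝ :=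
  ((hessL2Norm₁ Ω u1) ^ (2 : ℝ) + (hessL2Norm₁ Ω u2) ^ (2 : ℝ)) ^ ((1 : ℝ) / 2)

lemma oneD {f f' : ℝ → ℝ} {a b : ℝ} (hf : ∀ x, HasDerivAt f (f' x) x) (hc : Continuous f')
    {x z : ℝ} (hx : x ∈ Icc a b) (hz : z ∈ Icc a b) :
    f x - f z ≤ ∫ t in a..b, |f' t| := by
  have hab : a ≤ b := hx.1.trans hx.2
  have h1 : ∫ t in z..x, f' t = f x - f z :=
    intervalIntegral.integral_eq_sub_of_hasDerivAt (fun t _ => hf t) (hc.intervalIntegrable _ _)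
  rw [← h1]
  refine (le_abs_self _).trans ?_
  have h2 := intervalIntegral.norm_integral_le_integral_norm_uIoc (f := f') (a := z) (b := x)
    (μ := volume)
  rw [Real.norm_eq_abs] at h2
  refine h2.trans ?_
  rw [intervalIntegral.integral_of_le hab]
  refine setIntegral_mono_set ?_ ?_ ?_
  · exact (hc.abs.integrableOn_Icc (a := a) (b := b)).mono_set Ioc_subset_Icc_self
  · exact Filter.Eventually.of_forall (fun t => abs_nonneg _)
  · refine LE.le.eventuallyLE ?_
    intro t ht
    rw [uIoc, mem_Ioc] at ht
    exact ⟨lt_of_le_of_lt (le_min hz.1 hx.1) ht.1, ht.2.trans (max_le hz.2 hx.2)⟩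

lemma hasD1 {F : ℝ × ℝ → ℝ} (hF : Differentiable ℝ F) (x y : ℝ) :
    HasDerivAt (fun s => F (s, y)) (pd1 F (x, y)) x := by
  have h := (hF (x, y)).hasFDerivAt
  have h2 : HasDerivAt (fun s : ℝ => (s, y)) ((1 : ℝ), (0 : ℝ)) x :=
    (hasDerivAt_id x).prodMk (hasDerivAt_const x y)
  exact h.comp_hasDerivAt x h2

lemma hasD2 {F : ℝ × ℝ → ℝ} (hF : Differentiable ℝ F) (x y : ℝ) :
    HasDerivAt (fun s => F (x, s)) (pd2 F (x, y)) y := by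
  have h := (hF (x, y)).hasFDerivAt
  have h2 : HasDerivAt (fun s : ℝ => (x, s)) ((0 : ℝ), (1 : ℝ)) y :=
    (hasDerivAt_const y x).prodMk (hasDerivAt_id y)
  exact h.comp_hasDerivAt y h2

lemma cont1 {F : ℝ × ℝ → ℝ} (hF : ContDiff ℝ 1 F) : Continuous (pd1 F) :=
  (hF.continuous_fderiv (by norm_num)).clm_apply continuous_const

lemma cont2 {F : ℝ × ℝ → ℝ} (hF : ContDiff ℝ 1 F) : Continuous (pd2 F) :=
  (hF.continuous_fderiv (by norm_num)).clm_apply continuous_const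

lemma cd1 {F : ℝ × ℝ → ℝ} (hF : ContDiff ℝ 2 F) : ContDiff ℝ 1 (pd1 F) :=
  (hF.fderiv_right (m := 1) (by norm_num)).clm_apply contDiff_const

lemma cd2 {F : ℝ × ℝ → ℝ} (hF : ContDiff ℝ 2 F) : ContDiff ℝ 1 (pd2 F) :=
  (hF.fderiv_right (m := 1) (by norm_num)).clm_apply contDiff_const

lemma intOn {R : ℝ} {f : ℝ × ℝ → ℝ} (hf : Continuous f) : IntegrableOn f (OmegaR R) :=
  hf.continuousOn.integrableOn_compact (isCompact_Icc.prod isCompact_Icc)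

lemma measOmega (R : ℝ) : MeasurableSet (OmegaR R) := measurableSet_Icc.prod measurableSet_Icc

lemma lineH {R : ℝ} (hR : 0 < R) {a : ℝ × ℝ → ℝ} (ha : Continuous a) :
    Continuous (fun y => ∫ s in (-R)..R, a (s, y)) ∧
    ∫ y in Icc (0:ℝ) 1, (∫ s in (-R)..R, a (s, y)) = ∫ x in OmegaR R, a x := by
  constructor
  · exact intervalIntegral.continuous_parametric_intervalIntegral_of_continuous'
      (f := fun y s => a (s, y)) (by fun_prop) _ _
  · have h := intOn (R := R) ha
    unfold OmegaR at h ⊢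
    rw [Measure.volume_eq_prod, IntegrableOn, ← Measure.prod_restrict] at h
    rw [Measure.volume_eq_prod, ← Measure.prod_restrict, integral_prod_symm _ h]
    refine integral_congr_ae (Filter.Eventually.of_forall fun y => ?_)
    simp only
    rw [intervalIntegral.integral_of_le (by linarith), integral_Icc_eq_integral_Ioc]

lemma lineV {R : ℝ} {a : ℝ × ℝ → ℝ} (ha : Continuous a) :
    Continuous (fun x => ∫ s in (0:ℝ)..1, a (x, s)) ∧
    ∫ x in Icc (-R) R, (∫ s in (0:ℝ)..1, a (x, s)) = ∫ x in OmegaR R, a x := by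
  constructor
  · exact intervalIntegral.continuous_parametric_intervalIntegral_of_continuous'
      (f := fun y s => a (y, s)) (by fun_prop) _ _
  · have h := intOn (R := R) ha
    unfold OmegaR at h ⊢
    rw [Measure.volume_eq_prod, IntegrableOn, ← Measure.prod_restrict] at h
    rw [Measure.volume_eq_prod, ← Measure.prod_restrict, integral_prod _ h]
    refine integral_congr_ae (Filter.Eventually.of_forall fun y => ?_)
    simp only
    rw [intervalIntegral.integral_of_le (by norm_num), integral_Icc_eq_integral_Ioc]

lemma key {R : ℝ} (hR : 0 < R) {p a b : ℝ × ℝ → ℝ} (hp : Continuous p) (ha : Continuous a)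
    (hb : Continuous b) (p0 : ∀ x, 0 ≤ p x)
    (h1 : ∀ x ∈ Icc (-R) R, ∀ y ∈ Icc (0:ℝ) 1, p (x, y) ≤ ∫ s in (-R)..R, a (s, y))
    (h2 : ∀ x ∈ Icc (-R) R, ∀ y ∈ Icc (0:ℝ) 1, p (x, y) ≤ ∫ s in (0:ℝ)..1, b (x, s)) :
    ∫ x in OmegaR R, p x ^ 2 ≤ (∫ x in OmegaR R, a x) * ∫ x in OmegaR R, b x := by
  obtain ⟨ca, ea⟩ := lineH hR ha
  obtain ⟨cb, eb⟩ := lineV (R := R) hb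
  rw [← ea, ← eb, mul_comm]
  have := setIntegral_prod_mul (μ := (volume : Measure ℝ)) (ν := (volume : Measure ℝ))
    (fun x => ∫ s in (0:ℝ)..1, b (x, s)) (fun y => ∫ s in (-R)..R, a (s, y))
    (Icc (-R) R) (Icc (0:ℝ) 1)
  rw [← this, ← Measure.volume_eq_prod]
  change _ ≤ ∫ z in OmegaR R, _
  refine setIntegral_mono_on (intOn (by fun_prop)) (intOn ?_) (measOmega R) ?_
  · exact (cb.comp continuous_fst).mul (ca.comp continuous_snd)
  · rintro ⟨x, y⟩ ⟨hx, hy⟩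
    have e1 := h1 x hx y hy
    have e2 := h2 x hx y hy
    simp only
    rw [pow_two]
    exact mul_le_mul e2 e1 (p0 _) ((p0 _).trans e2)

lemma keyV {R : ℝ} {p b : ℝ × ℝ → ℝ} (hp : Continuous p)
    (hb : Continuous b)
    (h2 : ∀ x ∈ Icc (-R) R, ∀ y ∈ Icc (0:ℝ) 1, p (x, y) ≤ ∫ s in (0:ℝ)..1, b (x, s)) :
    ∫ x in OmegaR R, p x ≤ ∫ x in OmegaR R, b x := by
  obtain ⟨cb, eb⟩ := lineV (R := R) hb
  rw [← eb]
  have := setIntegral_prod_mul (μ := (volume : Measure ℝ)) (ν := (volume : Measure ℝ))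
    (fun x => ∫ s in (0:ℝ)..1, b (x, s)) (fun _ => 1)
    (Icc (-R) R) (Icc (0:ℝ) 1)
  have e : ∫ y in Icc (0:ℝ) 1, (1:ℝ) = 1 := by simp
  rw [e, mul_one] at this
  rw [← this, ← Measure.volume_eq_prod]
  change _ ≤ ∫ z in OmegaR R, _
  refine setIntegral_mono_on (intOn (by fun_prop)) (intOn ?_) (measOmega R) ?_
  · exact (cb.comp continuous_fst).mul continuous_const
  · rintro ⟨x, y⟩ ⟨hx, hy⟩
    simpa using h2 x hx y hy

lemma sqnn (R : ℝ) (f : ℝ × ℝ → ℝ) : 0 ≤ ∫ x in OmegaR R, f x ^ 2 :=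
  integral_nonneg fun x => sq_nonneg _

lemma cs {R : ℝ} {a b : ℝ × ℝ → ℝ} (ha : Continuous a) (hb : Continuous b) :
    ∫ x in OmegaR R, |a x| * |b x| ≤
      √(∫ x in OmegaR R, a x ^ 2) * √(∫ x in OmegaR R, b x ^ 2) := by
  have hm : ∀ {f : ℝ × ℝ → ℝ}, Continuous f → MemLp (fun x => |f x|) (ENNReal.ofReal 2)
      (volume.restrict (OmegaR R)) := by
    intro f hf
    rw [show ENNReal.ofReal 2 = 2 by norm_num, memLp_two_iff_integrable_sq
      hf.abs.aestronglyMeasurable]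
    exact intOn (by fun_prop)
  have := integral_mul_le_Lp_mul_Lq_of_nonneg (μ := volume.restrict (OmegaR R))
    (f := fun x => |a x|) (g := fun x => |b x|) (p := 2) (q := 2)
    (Real.HolderConjugate.two_two)
    (Filter.Eventually.of_forall fun x => abs_nonneg _)
    (Filter.Eventually.of_forall fun x => abs_nonneg _) (hm ha) (hm hb)
  simpa [Real.sqrt_eq_rpow] using this

lemma diffPow {f : ℝ → ℝ} {f' x : ℝ} (h : HasDerivAt f f' x) (m : ℕ) :
    HasDerivAt (fun s => f s ^ (m+1)) ((m+1 : ℝ) * f x ^ m * f') x := by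
  have := h.fun_pow (m+1)
  simpa using this

/-- line estimate for powers, horizontal -/
lemma powH {R : ℝ} {f : ℝ × ℝ → ℝ} (hf : ContDiff ℝ 1 f) (m : ℕ) {x z y : ℝ}
    (hx : x ∈ Icc (-R) R) (hz : z ∈ Icc (-R) R) (h0 : f (z, y) = 0) :
    |f (x, y)| ^ (m+1) ≤ ∫ s in (-R)..R, (m+1 : ℝ) * (|f (s, y) ^ m| * |pd1 f (s, y)|) := by
  have hd := fun s => diffPow (hasD1 (hf.differentiable (by norm_num)) s y) m
  have hc := hf.continuous
  have hc1 := cont1 hf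
  have hcc : Continuous (fun s => (m+1 : ℝ) * f (s, y) ^ m * pd1 f (s, y)) := by fun_prop
  have e1 := oneD hd hcc hx hz
  have e2 := oneD (fun s => (hd s)) hcc hz hx
  have e3 : ∀ s, |(m+1 : ℝ) * f (s, y) ^ m * pd1 f (s, y)| =
      (m+1 : ℝ) * (|f (s, y) ^ m| * |pd1 f (s, y)|) := by
    intro s
    rw [abs_mul, abs_mul, abs_of_nonneg (by positivity : (0:ℝ) ≤ m + 1), mul_assoc]
  simp only [e3, h0] at e1 e2
  rw [← abs_pow, abs_le]
  constructor
  · simp only [ne_eq, Nat.add_eq_zero_iff, one_ne_zero, and_false, not_false_eq_true, zero_pow] at e2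
    linarith
  · simp only [ne_eq, Nat.add_eq_zero_iff, one_ne_zero, and_false, not_false_eq_true, zero_pow] at e1
    linarith

lemma powV {f : ℝ × ℝ → ℝ} (hf : ContDiff ℝ 1 f) (m : ℕ) {x z y : ℝ}
    (hy : y ∈ Icc (0:ℝ) 1) (hz : z ∈ Icc (0:ℝ) 1) (h0 : f (x, z) = 0) :
    |f (x, y)| ^ (m+1) ≤ ∫ s in (0:ℝ)..1, (m+1 : ℝ) * (|f (x, s) ^ m| * |pd2 f (x, s)|) := by
  have hd := fun s => diffPow (hasD2 (hf.differentiable (by norm_num)) x s) m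
  have hc := hf.continuous
  have hc1 := cont2 hf
  have hcc : Continuous (fun s => (m+1 : ℝ) * f (x, s) ^ m * pd2 f (x, s)) := by fun_prop
  have e1 := oneD hd hcc hy hz
  have e2 := oneD (fun s => (hd s)) hcc hz hy
  have e3 : ∀ s, |(m+1 : ℝ) * f (x, s) ^ m * pd2 f (x, s)| =
      (m+1 : ℝ) * (|f (x, s) ^ m| * |pd2 f (x, s)|) := by
    intro s
    rw [abs_mul, abs_mul, abs_of_nonneg (by positivity : (0:ℝ) ≤ m + 1), mul_assoc]
  simp only [e3, h0] at e1 e2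
  rw [← abs_pow, abs_le]
  constructor
  · simp only [ne_eq, Nat.add_eq_zero_iff, one_ne_zero, and_false, not_false_eq_true, zero_pow] at e2
    linarith
  · simp only [ne_eq, Nat.add_eq_zero_iff, one_ne_zero, and_false, not_false_eq_true, zero_pow] at e1
    linarith

/-- all even moments -/
lemma moments {R : ℝ} (hR : 0 < R) {f : ℝ × ℝ → ℝ} (hf : ContDiff ℝ 1 f)
    (hh : ∀ y ∈ Icc (0:ℝ) 1, ∃ z ∈ Icc (-R) R, f (z, y) = 0)
    (hv : ∀ x ∈ Icc (-R) R, ∃ z ∈ Icc (0:ℝ) 1, f (x, z) = 0) {D : ℝ} (hD : 0 ≤ D)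
    (hD1 : ∫ x in OmegaR R, pd1 f x ^ 2 ≤ D ^ 2) (hD2 : ∫ x in OmegaR R, pd2 f x ^ 2 ≤ D ^ 2)
    (m : ℕ) :
    ∫ x in OmegaR R, f x ^ (2 * (m + 1)) ≤ 4 * ((m+1).factorial : ℝ) ^ 2 * D ^ (2 * (m + 1)) := by
  have hc := hf.continuous
  have hc1 := cont1 hf
  have hc2 := cont2 hf
  have s1 : √(∫ x in OmegaR R, pd1 f x ^ 2) ≤ D := Real.sqrt_le_iff.2 ⟨hD, hD1⟩
  have s2 : √(∫ x in OmegaR R, pd2 f x ^ 2) ≤ D := Real.sqrt_le_iff.2 ⟨hD, hD2⟩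
  induction m with
  | zero =>
    have h := keyV (R := R) (p := fun x => |f x| ^ (1+1))
      (b := fun x => ((1:ℕ)+1 : ℝ) * (|f x ^ 1| * |pd2 f x|)) (by fun_prop) (by fun_prop)
      (by
        intro x hx y hy
        obtain ⟨z, hz, h0⟩ := hv x hx
        exact powV hf 1 hy hz h0)
    have h2 := cs (R := R) hc hc2
    rw [integral_const_mul] at h
    simp only [pow_one, Nat.reduceAdd, sq_abs] at h
    have hE := sqnn R f
    set E := ∫ x in OmegaR R, f x ^ 2
    have hs := Real.sq_sqrt hE
    have hs0 := Real.sqrt_nonneg E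
    have h3 : √E * √(∫ x in OmegaR R, pd2 f x ^ 2) ≤ √E * D := by gcongr
    norm_num at h ⊢
    change E ≤ _
    have h4 : √E ^ 2 ≤ 2 * (√E * D) := by rw [hs]; linarith
    have h5 : √E ≤ 2 * D := by
      by_contra hcon
      push Not at hcon
      nlinarith
    nlinarith
  | succ m ih =>
    have h := key hR (p := fun x => |f x| ^ (m+1+1))
      (a := fun x => ((m+1:ℕ)+1 : ℝ) * (|f x ^ (m+1)| * |pd1 f x|))
      (b := fun x => ((m+1:ℕ)+1 : ℝ) * (|f x ^ (m+1)| * |pd2 f x|)) (by fun_prop) (by fun_prop)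
      (by fun_prop) (fun x => by positivity)
      (by
        intro x hx y hy
        obtain ⟨z, hz, h0⟩ := hh y hy
        exact powH hf (m+1) hx hz h0)
      (by
        intro x hx y hy
        obtain ⟨z, hz, h0⟩ := hv x hx
        exact powV hf (m+1) hy hz h0)
    have c1 := cs (R := R) (a := fun x => f x ^ (m+1)) (by fun_prop) hc1
    have c2 := cs (R := R) (a := fun x => f x ^ (m+1)) (by fun_prop) hc2
    rw [integral_const_mul, integral_const_mul] at h
    have hE := sqnn R (fun x => f x ^ (m+1))
    have eE : ∫ x in OmegaR R, (f x ^ (m+1)) ^ 2 = ∫ x in OmegaR R, f x ^ (2 * (m+1)) := by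
      congr 1; ext x; rw [← pow_mul, mul_comm]
    have eL : ∫ x in OmegaR R, (|f x| ^ (m+1+1)) ^ 2 = ∫ x in OmegaR R, f x ^ (2 * (m+1+1)) := by
      congr 1; ext x; rw [← abs_pow, sq_abs, ← pow_mul, mul_comm]
    rw [eL] at h
    simp only [eE] at hE c1 c2
    set E := ∫ x in OmegaR R, f x ^ (2 * (m+1))
    have hs := Real.sq_sqrt hE
    have d1 : ∫ x in OmegaR R, |f x ^ (m+1)| * |pd1 f x| ≤ √E * D := c1.trans (by gcongr)
    have d2 : ∫ x in OmegaR R, |f x ^ (m+1)| * |pd2 f x| ≤ √E * D := c2.trans (by gcongr)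
    have n2 : 0 ≤ ∫ x in OmegaR R, |f x ^ (m+1)| * |pd2 f x| :=
      integral_nonneg fun x => by positivity
    refine h.trans ?_
    calc _ ≤ (((m+1:ℕ)+1 : ℝ) * (√E * D)) * (((m+1:ℕ)+1 : ℝ) * (√E * D)) := by gcongr
      _ = ((m+1:ℕ)+1 : ℝ)^2 * D^2 * E := by linear_combination (((m+1:ℕ)+1 : ℝ)^2 * D^2) * hs
      _ ≤ ((m+1:ℕ)+1 : ℝ)^2 * D^2 * (4 * ((m+1).factorial : ℝ) ^ 2 * D ^ (2 * (m + 1))) := by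
          gcongr
      _ = _ := by
          rw [Nat.factorial_succ (m+1)]; push_cast; ring

lemma lq_pow {q : ℝ} (hq : 0 < q) (R : ℝ) (f : ℝ × ℝ → ℝ) :
    lqNorm q (OmegaR R) f ^ q = ∫ x in OmegaR R, |f x| ^ q := by
  unfold lqNorm
  rw [← Real.rpow_mul (integral_nonneg fun x => by positivity), one_div_mul_cancel hq.ne',
    Real.rpow_one]

lemma l2_pow (R : ℝ) (f : ℝ × ℝ → ℝ) :
    lqNorm 2 (OmegaR R) f ^ (2:ℝ) = ∫ x in OmegaR R, f x ^ 2 := by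
  rw [lq_pow (by norm_num)]
  simp

lemma lqBound {q : ℝ} (hq : 2 ≤ q) {R : ℝ} (hR : 0 < R) {f : ℝ × ℝ → ℝ} (hf : ContDiff ℝ 1 f)
    (hh : ∀ y ∈ Icc (0:ℝ) 1, ∃ z ∈ Icc (-R) R, f (z, y) = 0)
    (hv : ∀ x ∈ Icc (-R) R, ∃ z ∈ Icc (0:ℝ) 1, f (x, z) = 0) {D : ℝ} (hD : 0 ≤ D)
    (hD1 : ∫ x in OmegaR R, pd1 f x ^ 2 ≤ D ^ 2) (hD2 : ∫ x in OmegaR R, pd2 f x ^ 2 ≤ D ^ 2)  :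
    ∫ x in OmegaR R, |f x| ^ q ≤ (4 + 4 * ((⌈q⌉₊+1).factorial : ℝ) ^ 2) * D ^ q := by
  have hc := hf.continuous
  set m := ⌈q⌉₊
  have hm : q ≤ m := Nat.le_ceil q
  have M0 := moments hR hf hh hv hD hD1 hD2 0
  have Mm := moments hR hf hh hv hD hD1 hD2 m
  rcases hD.eq_or_lt with h0 | hpos
  · subst h0
    have h1 : ∫ x in OmegaR R, f x ^ 2 = 0 := le_antisymm (by simpa using M0) (sqnn R f)
    rw [integral_eq_zero_iff_of_nonneg (fun x => sq_nonneg _) (intOn (hc.pow 2))] at h1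
    have hq00 : q ≠ 0 := by linarith
    have : ∫ x in OmegaR R, |f x| ^ q = 0 := by
      rw [integral_eq_zero_iff_of_nonneg (fun x => by positivity)
        (intOn (hc.abs.rpow_const fun x => Or.inr (by linarith)))]
      filter_upwards [h1] with x hx
      have : f x = 0 := by simpa using hx
      simp [this, Real.zero_rpow hq00]
    rw [this, Real.zero_rpow (by linarith)]
    simp
  · have pt : ∀ x, |f x| ^ q ≤ D ^ q * (f x ^ (2*(0+1)) / D ^ (2*(0+1)) + f x ^ (2*(m+1)) / D ^ (2*(m+1))) := by
      intro x
      have e1 : ∀ k : ℕ, f x ^ (2 * (k+1)) / D ^ (2 * (k+1)) = (|f x| / D) ^ (2*(k+1)) := by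
        intro k
        rw [div_pow, Even.pow_abs ⟨k+1, by ring⟩]
      have e2 : |f x| ^ q = D ^ q * (|f x| / D) ^ q := by
        rw [Real.div_rpow (abs_nonneg _) hD]
        have := (Real.rpow_pos_of_pos hpos q).ne'
        field_simp
      rw [e1, e1, e2]
      set t := |f x| / D
      have ht : 0 ≤ t := by positivity
      gcongr
      rcases le_total t 1 with h | h
      · have : t ^ q ≤ t ^ (2 * (0+1)) := by
          rw [← Real.rpow_natCast]
          rcases ht.eq_or_lt with h0 | h0
          · rw [← h0, Real.zero_rpow (by linarith)]; simp
          · exact Real.rpow_le_rpow_of_exponent_ge h0 h (by push_cast; linarith)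
        have : 0 ≤ t ^ (2 * (m+1)) := by positivity
        linarith
      · have : t ^ q ≤ t ^ (2 * (m+1)) := by
          rw [← Real.rpow_natCast]
          exact Real.rpow_le_rpow_of_exponent_le h (by push_cast; linarith)
        have : 0 ≤ t ^ (2 * (0+1)) := by positivity
        linarith
    have I1 : ∫ x in OmegaR R, |f x| ^ q ≤ ∫ x in OmegaR R, D ^ q * (f x ^ (2*(0+1)) / D ^ (2*(0+1)) + f x ^ (2*(m+1)) / D ^ (2*(m+1))) :=
      integral_mono (intOn (hc.abs.rpow_const fun x => Or.inr (by linarith)))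
        (intOn (by fun_prop)) pt
    refine I1.trans ?_
    rw [integral_const_mul, integral_add (intOn (by fun_prop)) (intOn (by fun_prop)),
      integral_div, integral_div, mul_comm]
    gcongr
    · rw [div_le_iff₀ (by positivity)]; simpa using M0
    · rw [div_le_iff₀ (by positivity)]; exact Mm

lemma zero_deriv {g : ℝ → ℝ} {g' a b x : ℝ} (hab : a < b) (hx : x ∈ Icc a b)
    (h0 : ∀ t ∈ Icc a b, g t = 0) (h : HasDerivAt g g' x) : g' = 0 := by
  have h1 : HasDerivWithinAt g 0 (Icc a b) x :=
    (hasDerivWithinAt_const x (Icc a b) (0:ℝ)).congr (fun t ht => h0 t ht) (h0 x hx)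
  exact (uniqueDiffOn_Icc hab x hx).eq_deriv _ h.hasDerivWithinAt h1

lemma rolle {g g' : ℝ → ℝ} {a b : ℝ} (hab : a < b) (ha : g a = 0) (hb : g b = 0)
    (h : ∀ x, HasDerivAt g (g' x) x) : ∃ z ∈ Icc a b, g' z = 0 := by
  obtain ⟨z, hz, e⟩ := exists_hasDerivAt_eq_zero hab
    (fun x _ => (h x).continuousAt.continuousWithinAt) (ha.trans hb.symm) (fun x _ => h x)
  exact ⟨z, Ioo_subset_Icc_self hz, e⟩

lemma half_sq {a : ℝ} (ha : 0 ≤ a) : (a ^ ((1:ℝ)/2)) ^ 2 = a := by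
  rw [← Real.sqrt_eq_rpow, Real.sq_sqrt ha]

lemma hess1_sq (R : ℝ) (u : ℝ × ℝ → ℝ) : 0 ≤ hessL2Norm₁ (OmegaR R) u ∧
    hessL2Norm₁ (OmegaR R) u ^ 2 = (∫ x in OmegaR R, pd1 (pd1 u) x ^ 2) +
      (∫ x in OmegaR R, pd1 (pd2 u) x ^ 2) + (∫ x in OmegaR R, pd2 (pd1 u) x ^ 2) +
      (∫ x in OmegaR R, pd2 (pd2 u) x ^ 2) := by
  have h1 := sqnn R (pd1 (pd1 u))
  have h2 := sqnn R (pd1 (pd2 u))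
  have h3 := sqnn R (pd2 (pd1 u))
  have h4 := sqnn R (pd2 (pd2 u))
  unfold hessL2Norm₁
  simp only [l2_pow]
  exact ⟨by positivity, half_sq (by positivity)⟩

lemma grad_sq (R : ℝ) (u : ℝ × ℝ → ℝ) : 0 ≤ gradL2Norm₁ (OmegaR R) u ∧
    gradL2Norm₁ (OmegaR R) u ^ 2 = (∫ x in OmegaR R, pd1 u x ^ 2) +
      (∫ x in OmegaR R, pd2 u x ^ 2) := by
  have h1 := sqnn R (pd1 u)
  have h2 := sqnn R (pd2 u)
  unfold gradL2Norm₁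
  simp only [l2_pow]
  exact ⟨by positivity, half_sq (by positivity)⟩

lemma hess_sq (R : ℝ) (u v : ℝ × ℝ → ℝ) : 0 ≤ hessL2Norm (OmegaR R) u v ∧
    hessL2Norm (OmegaR R) u v ^ 2 = hessL2Norm₁ (OmegaR R) u ^ 2 +
      hessL2Norm₁ (OmegaR R) v ^ 2 := by
  unfold hessL2Norm
  simp only [Real.rpow_two]
  exact ⟨by positivity, half_sq (by positivity)⟩

lemma l4 {R : ℝ} (hR : 0 < R) {f : ℝ × ℝ → ℝ} (hf : ContDiff ℝ 1 f)
    (hh : ∀ y ∈ Icc (0:ℝ) 1, ∃ z ∈ Icc (-R) R, f (z, y) = 0) {G H : ℝ} (hG : 0 ≤ G) (hH : 0 ≤ H)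
    (h0 : ∫ x in OmegaR R, f x ^ 2 ≤ G ^ 2)
    (hD1 : ∫ x in OmegaR R, pd1 f x ^ 2 ≤ H ^ 2) (hD2 : ∫ x in OmegaR R, pd2 f x ^ 2 ≤ H ^ 2) :
    ∫ x in OmegaR R, f x ^ 4 ≤ (2 * (G * H)) * (G ^ 2 + 2 * (G * H)) := by
  have hc := hf.continuous
  have hc1 := cont1 hf
  have hc2 := cont2 hf
  have s0 : √(∫ x in OmegaR R, f x ^ 2) ≤ G := Real.sqrt_le_iff.2 ⟨hG, h0⟩
  have s1 : √(∫ x in OmegaR R, pd1 f x ^ 2) ≤ H := Real.sqrt_le_iff.2 ⟨hH, hD1⟩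
  have s2 : √(∫ x in OmegaR R, pd2 f x ^ 2) ≤ H := Real.sqrt_le_iff.2 ⟨hH, hD2⟩
  have h := key hR (p := fun x => |f x| ^ (1+1))
      (a := fun x => ((1:ℕ)+1 : ℝ) * (|f x ^ 1| * |pd1 f x|))
      (b := fun x => f x ^ 2 + 2 * (|f x| * |pd2 f x|)) (by fun_prop) (by fun_prop)
      (by fun_prop) (fun x => by positivity)
      (by
        intro x hx y hy
        obtain ⟨z, hz, h0⟩ := hh y hy
        exact powH hf 1 hx hz h0)
      (by
        intro x hx y hy
        have hd := fun s => diffPow (hasD2 (hf.differentiable (by norm_num)) x s) 1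
        have hcc : Continuous (fun s => ((1:ℕ)+1 : ℝ) * f (x, s) ^ 1 * pd2 f (x, s)) := by fun_prop
        have e1 := fun z (hz : z ∈ Icc (0:ℝ) 1) => oneD hd hcc hy hz
        have e3 : ∀ s, |((1:ℕ)+1 : ℝ) * f (x, s) ^ 1 * pd2 f (x, s)| =
            2 * (|f (x, s)| * |pd2 f (x, s)|) := by
          intro s
          rw [abs_mul, abs_mul]; norm_num; ring
        simp only [e3, Nat.reduceAdd] at e1
        rw [intervalIntegral.integral_add (Continuous.intervalIntegrable (by fun_prop) _ _)
          (Continuous.intervalIntegrable (by fun_prop) _ _)]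
        set J := ∫ s in (0:ℝ)..1, 2 * (|f (x, s)| * |pd2 f (x, s)|)
        have e4 : ∫ z in (0:ℝ)..1, (f (x, y) ^ 2 - J) ≤ ∫ z in (0:ℝ)..1, f (x, z) ^ 2 :=
          intervalIntegral.integral_mono_on (by norm_num)
            (Continuous.intervalIntegrable (by fun_prop) _ _)
            (Continuous.intervalIntegrable (by fun_prop) _ _)
            (fun z hz => by have := e1 z hz; linarith)
        rw [intervalIntegral.integral_const] at e4
        simp only [sub_zero, one_smul] at e4
        norm_num
        linarith)
  have c1 := cs (R := R) hc hc1
  have c2 := cs (R := R) hc hc2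
  have d1 : ∫ x in OmegaR R, |f x| * |pd1 f x| ≤ G * H := c1.trans (by gcongr)
  have d2 : ∫ x in OmegaR R, |f x| * |pd2 f x| ≤ G * H := c2.trans (by gcongr)
  have n2 : 0 ≤ ∫ x in OmegaR R, |f x| * |pd2 f x| :=
      integral_nonneg fun x => by positivity
  have n0 := sqnn R f
  rw [integral_const_mul, integral_add (intOn (by fun_prop)) (intOn (by fun_prop)),
    integral_const_mul] at h
  simp only [pow_one] at h
  have eL : ∫ x in OmegaR R, (|f x| ^ (1+1)) ^ 2 = ∫ x in OmegaR R, f x ^ 4 := by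
    congr 1; ext x; norm_num; ring
  rw [eL] at h
  refine h.trans ?_
  norm_num
  gcongr

/-- Second-order estimates with constants independent of the horizontal length `R`. -/
theorem second_order_estimates (μ k0 k1 : ℝ) (hμ : 0 < μ) (hk0 : k0 ≤ 0) (hk1 : k1 ≤ 0)
    (q : ℝ) (hq : 2 ≤ q) :
    ∃ Cq C : ℝ, 0 < Cq ∧ 0 < C ∧ ∀ R : ℝ, 0 < R → ∀ u1 u2 : ℝ × ℝ → ℝ,
      ContDiff ℝ 2 u1 → ContDiff ℝ 2 u2 →
      (∀ x ∈ OmegaR R, pd1 u1 x + pd2 u2 x = 0) →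
      (∀ x₂ ∈ Icc (0 : ℝ) 1,
        u1 (-R, x₂) = 0 ∧ u1 (R, x₂) = 0 ∧ u2 (-R, x₂) = 0 ∧ u2 (R, x₂) = 0) →
      (∀ x₁ ∈ Icc (-R) R,
        u2 (x₁, 0) = 0 ∧ u2 (x₁, 1) = 0 ∧
        pd2 u1 (x₁, 1) = (k1 / μ) * u1 (x₁, 1) ∧
        pd2 u1 (x₁, 0) = -(k0 / μ) * u1 (x₁, 0)) →
      lqNormVec q (OmegaR R) (pd1 u2) (pd2 u2) ≤ Cq * hessL2Norm (OmegaR R) u1 u2 ∧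
      lqNorm 4 (OmegaR R) (pd2 u1) ≤
        C * ((hessL2Norm₁ (OmegaR R) u1) ^ ((1 : ℝ) / 2) *
              (gradL2Norm₁ (OmegaR R) u1) ^ ((1 : ℝ) / 2) +
            (gradL2Norm₁ (OmegaR R) u1) ^ ((3 : ℝ) / 4) *
              (hessL2Norm₁ (OmegaR R) u1) ^ ((1 : ℝ) / 4)) := by
  set K : ℝ := 4 + 4 * ((⌈q⌉₊+1).factorial : ℝ) ^ 2 with hK
  have hKpos : 0 < K := by positivity
  have hq0 : 0 < q := by linarith
  refine ⟨(2 * K) ^ (1 / q), 2, by positivity, by norm_num, ?_⟩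
  intro R hR u1 u2 hu1 hu2 _ hlat hnav
  have du1 : Differentiable ℝ u1 := hu1.differentiable (by norm_num)
  have du2 : Differentiable ℝ u2 := hu2.differentiable (by norm_num)
  have hRR : -R < R := by linarith
  constructor
  · obtain ⟨H0, Hsq⟩ := hess_sq R u1 u2
    have Hs2 := (hess1_sq R u2).2
    set H := hessL2Norm (OmegaR R) u1 u2
    have h1 := sqnn R (pd1 (pd1 u2))
    have h2 := sqnn R (pd1 (pd2 u2))
    have h3 := sqnn R (pd2 (pd1 u2))
    have h4 := sqnn R (pd2 (pd2 u2))
    have h5 := sq_nonneg (hessL2Norm₁ (OmegaR R) u1)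
    have b1 : ∫ x in OmegaR R, |pd1 u2 x| ^ q ≤ K * H ^ q := by
      refine lqBound hq hR (cd1 hu2) ?_ ?_ H0 (by linarith) (by linarith)
      · intro y hy
        exact rolle (g := fun s => u2 (s, y)) (g' := fun s => pd1 u2 (s, y)) hRR
          (hlat y hy).2.2.1 (hlat y hy).2.2.2 (fun s => hasD1 du2 s y)
      · intro x hx
        exact ⟨0, by simp, zero_deriv hRR hx (fun t ht => (hnav t ht).1) (hasD1 du2 x 0)⟩
    have b2 : ∫ x in OmegaR R, |pd2 u2 x| ^ q ≤ K * H ^ q := by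
      refine lqBound hq hR (cd2 hu2) ?_ ?_ H0 (by linarith) (by linarith)
      · intro y hy
        exact ⟨-R, ⟨le_refl _, hRR.le⟩, zero_deriv zero_lt_one hy
          (fun t ht => (hlat t ht).2.2.1) (hasD2 du2 (-R) y)⟩
      · intro x hx
        exact rolle (g := fun s => u2 (x, s)) (g' := fun s => pd2 u2 (x, s)) zero_lt_one
          (hnav x hx).1 (hnav x hx).2.1 (fun s => hasD2 du2 x s)
    unfold lqNormVec
    rw [lq_pow hq0, lq_pow hq0]
    have e : (2 * K) ^ (1 / q) * H = (2 * K * H ^ q) ^ (1 / q) := by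
      rw [Real.mul_rpow (x := 2 * K) (y := H ^ q) (by positivity) (by positivity), ← Real.rpow_mul H0,
        mul_one_div_cancel hq0.ne', Real.rpow_one]
    rw [e]
    have n1 : 0 ≤ ∫ x in OmegaR R, |pd1 u2 x| ^ q := integral_nonneg fun x => by positivity
    have n2 : 0 ≤ ∫ x in OmegaR R, |pd2 u2 x| ^ q := integral_nonneg fun x => by positivity
    exact Real.rpow_le_rpow (by positivity) (by linarith) (by positivity)
  · obtain ⟨H0, Hsq⟩ := hess1_sq R u1
    obtain ⟨G0, Gsq⟩ := grad_sq R u1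
    set H := hessL2Norm₁ (OmegaR R) u1
    set G := gradL2Norm₁ (OmegaR R) u1
    have h1 := sqnn R (pd1 (pd1 u1))
    have h2 := sqnn R (pd1 (pd2 u1))
    have h3 := sqnn R (pd2 (pd1 u1))
    have h4 := sqnn R (pd2 (pd2 u1))
    have h5 := sqnn R (pd1 u1)
    have b := l4 hR (cd2 hu1) (by
        intro y hy
        exact ⟨-R, ⟨le_refl _, hRR.le⟩, zero_deriv zero_lt_one hy
          (fun t ht => (hlat t ht).1) (hasD2 du1 (-R) y)⟩) G0 H0 (by linarith) (by linarith)
        (by linarith)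
    have eX : (H ^ ((1:ℝ)/2) * G ^ ((1:ℝ)/2)) ^ 4 = H ^ 2 * G ^ 2 := by
      rw [mul_pow, ← Real.rpow_mul_natCast H0, ← Real.rpow_mul_natCast G0]
      norm_num
    have eY : (G ^ ((3:ℝ)/4) * H ^ ((1:ℝ)/4)) ^ 4 = G ^ 3 * H := by
      rw [mul_pow, ← Real.rpow_mul_natCast H0, ← Real.rpow_mul_natCast G0]
      norm_num
    have X0 : 0 ≤ H ^ ((1:ℝ)/2) * G ^ ((1:ℝ)/2) := by positivity
    have Y0 : 0 ≤ G ^ ((3:ℝ)/4) * H ^ ((1:ℝ)/4) := by positivity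
    set X := H ^ ((1:ℝ)/2) * G ^ ((1:ℝ)/2)
    set Y := G ^ ((3:ℝ)/4) * H ^ ((1:ℝ)/4)
    have e4 : ∫ x in OmegaR R, |pd2 u1 x| ^ (4:ℝ) = ∫ x in OmegaR R, pd2 u1 x ^ 4 := by
      congr 1; ext x
      rw [show (4:ℝ) = ((4:ℕ):ℝ) by norm_num, Real.rpow_natCast, Even.pow_abs ⟨2, rfl⟩]
    unfold lqNorm
    rw [e4]
    have n4 : 0 ≤ ∫ x in OmegaR R, pd2 u1 x ^ 4 :=
      integral_nonneg fun x => Even.pow_nonneg ⟨2, rfl⟩ _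
    have le : ∫ x in OmegaR R, pd2 u1 x ^ 4 ≤ (2 * (X + Y)) ^ (4:ℝ) := by
      rw [show (4:ℝ) = ((4:ℕ):ℝ) by norm_num, Real.rpow_natCast]
      have : 0 ≤ X ^ 3 * Y := by positivity
      have : 0 ≤ X ^ 2 * Y ^ 2 := by positivity
      have : 0 ≤ X * Y ^ 3 := by positivity
      have : 0 ≤ X ^ 4 := by positivity
      have : 0 ≤ Y ^ 4 := by positivity
      nlinarith
    refine (Real.rpow_le_rpow n4 le (by norm_num)).trans (le_of_eq ?_)
    rw [← Real.rpow_mul (by positivity)]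
    norm_num
end
end

section
/- Well-posedness of the transport equation by characteristics: let T > 0, R > 0, and let u = (u₁,u₂) : [0,T]×Ω_R → ℝ² be continuous with continuous spatial partial derivatives ∂₁u and ∂₂u on [0,T]×Ω_R, satisfying ∂₁u₁ + ∂₂u₂ = 0 on [0,T]×Ω_R, u₂(t,x₁,0) = u₂(t,x₁,1) = 0 for all t ∈ [0,T] and x₁ ∈ [-R,R], and u(t,·) = 0 on the lateral sides {±R}×[0,1] for all t ∈ [0,T]. Then for every continuously differentiable θ̄₀ : Ω_R → ℝ there exists a unique continuously differentiable θ : [0,T]×Ω_R → ℝ such that ∂_tθ + u₁∂₁θ + u₂∂₂θ = 0 on [0,T]×Ω_R and θ(0,·) = θ̄₀. -/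
open MeasureTheory Set

noncomputable section

/-- spatial partial derivative in the horizontal direction of a
time-dependent scalar field `f(t, x₁, x₂)` -/
def sd1 (f : ℝ × ℝ × ℝ → ℝ) (p : ℝ × ℝ × ℝ) : ℝ :=
  fderiv ℝ (fun y : ℝ × ℝ => f (p.1, y)) p.2 (1, 0)

/-- spatial partial derivative in the vertical direction -/
def sd2 (f : ℝ × ℝ × ℝ → ℝ) (p : ℝ × ℝ × ℝ) : ℝ :=
  fderiv ℝ (fun y : ℝ × ℝ => f (p.1, y)) p.2 (0, 1)

/-- time derivative of a time-dependent scalar field -/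
def td (f : ℝ × ℝ × ℝ → ℝ) (p : ℝ × ℝ × ℝ) : ℝ :=
  deriv (fun s : ℝ => f (s, p.2)) p.1


theorem aux_bound_pos {E : Type*} [NormedAddCommGroup E] [NormedSpace ℝ E]
    (h : ℝ → E) (c k : ℝ) (hk : 0 < k) (hc : 0 ≤ c)
    (hb : ∀ r, ‖h r‖ ≤ c * Real.exp (k * |r|)) (s : ℝ) (hs : 0 ≤ s) :
    ‖∫ r in (0:ℝ)..s, h r‖ ≤ c * Real.exp (k * |s|) / k := by
  have h1 : ‖∫ r in (0:ℝ)..s, h r‖ ≤ ∫ r in (0:ℝ)..s, c * Real.exp (k * r) := by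
    apply intervalIntegral.norm_integral_le_of_norm_le hs
    · refine Filter.Eventually.of_forall fun r hr => ?_
      have := hb r
      rwa [abs_of_nonneg hr.1.le] at this
    · apply Continuous.intervalIntegrable
      fun_prop
  have h2 : ∫ r in (0:ℝ)..s, c * Real.exp (k * r) = c * Real.exp (k * s) / k - c / k := by
    have := intervalIntegral.integral_eq_sub_of_hasDerivAt (a := 0) (b := s)
      (f := fun r => c * Real.exp (k * r) / k) (f' := fun r => c * Real.exp (k * r))
      (fun r _ => by
        have h3 : HasDerivAt (fun r : ℝ => k * r) k r := by
          simpa using (hasDerivAt_id r).const_mul k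
        convert! ((h3.exp).const_mul c).div_const k using 1
        field_simp) (by apply Continuous.intervalIntegrable; fun_prop)
    rw [this]; simp
  rw [h2] at h1
  rw [abs_of_nonneg hs]
  have : 0 ≤ c / k := by positivity
  linarith

theorem aux_bound {E : Type*} [NormedAddCommGroup E] [NormedSpace ℝ E]
    (h : ℝ → E) (c k : ℝ) (hk : 0 < k) (hc : 0 ≤ c)
    (hb : ∀ r, ‖h r‖ ≤ c * Real.exp (k * |r|)) (s : ℝ) :
    ‖∫ r in (0:ℝ)..s, h r‖ ≤ c * Real.exp (k * |s|) / k := by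
  rcases le_total 0 s with hs | hs
  · exact aux_bound_pos h c k hk hc hb s hs
  · have := aux_bound_pos (fun r => h (-r)) c k hk hc
      (fun r => by simpa using hb (-r)) (-s) (by linarith)
    rw [intervalIntegral.integral_comp_neg, intervalIntegral.integral_symm] at this
    simpa using this

open BoundedContinuousFunction in
theorem volterra {P E : Type*} [TopologicalSpace P] [FirstCountableTopology P]
    [LocallyCompactSpace P] [NormedAddCommGroup E] [NormedSpace ℝ E] [CompleteSpace E]
    (g : P → ℝ → E → E) (hg : Continuous fun q : P × ℝ × E => g q.1 q.2.1 q.2.2)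
    (C L : ℝ) (hC : 0 ≤ C) (hL : 0 ≤ L) (h0 : ∀ p r, ‖g p r 0‖ ≤ C)
    (hlip : ∀ p r x y, ‖g p r x - g p r y‖ ≤ L * ‖x - y‖) :
    ∃ Z : P → ℝ → E, (Continuous fun q : P × ℝ => Z q.1 q.2) ∧
      (∀ p, Z p 0 = 0) ∧ ∀ p s, HasDerivAt (Z p) (g p s (Z p s)) s := by
  set k : ℝ := 2 * L + 2 with hk
  have hkpos : 0 < k := by positivity
  have hLk : L / k ≤ 1 / 2 := by
    rw [div_le_iff₀ hkpos]; linarith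
  let G : ((P × ℝ) →ᵇ E) → P → ℝ → E := fun Y p r => g p r (Real.exp (k * |r|) • Y (p, r))
  have hGc : ∀ Y, Continuous fun q : P × ℝ => G Y q.1 q.2 := fun Y => by
    have hY := Y.continuous
    have : Continuous fun q : P × ℝ => (q.1, q.2, Real.exp (k * |q.2|) • Y (q.1, q.2)) := by
      fun_prop
    exact hg.comp this
  have hint : ∀ Y, Continuous fun q : P × ℝ => ∫ r in (0:ℝ)..q.2, G Y q.1 r := fun Y =>
    intervalIntegral.continuous_parametric_primitive_of_continuous (hGc Y)
  have hexp1 : ∀ r : ℝ, 1 ≤ Real.exp (k * |r|) := fun r => Real.one_le_exp (by positivity)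
  have hGb : ∀ Y p r, ‖G Y p r‖ ≤ (C + L * ‖Y‖) * Real.exp (k * |r|) := fun Y p r => by
    have h1 := hlip p r (Real.exp (k * |r|) • Y (p, r)) 0
    have h2 : ‖G Y p r‖ ≤ ‖g p r (Real.exp (k * |r|) • Y (p, r)) - g p r 0‖ + ‖g p r 0‖ :=
      norm_le_norm_sub_add _ _
    have h3 := h0 p r
    rw [sub_zero, norm_smul, Real.norm_of_nonneg (Real.exp_pos _).le] at h1
    have h4 : L * (Real.exp (k * |r|) * ‖Y (p, r)‖) ≤ L * (Real.exp (k * |r|) * ‖Y‖) := by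
      gcongr; exact Y.norm_coe_le_norm _
    nlinarith [hexp1 r]
  have hGd : ∀ Y Y' p r, ‖G Y p r - G Y' p r‖ ≤ (L * ‖Y - Y'‖) * Real.exp (k * |r|) :=
    fun Y Y' p r => by
    have h1 := hlip p r (Real.exp (k * |r|) • Y (p, r)) (Real.exp (k * |r|) • Y' (p, r))
    rw [← smul_sub, norm_smul, Real.norm_of_nonneg (Real.exp_pos _).le] at h1
    have h4 : L * (Real.exp (k * |r|) * ‖Y (p, r) - Y' (p, r)‖) ≤
        L * (Real.exp (k * |r|) * ‖Y - Y'‖) := by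
      gcongr; exact (Y - Y').norm_coe_le_norm _
    have h5 : ‖G Y p r - G Y' p r‖ ≤ L * (Real.exp (k * |r|) * ‖Y - Y'‖) := h1.trans h4
    linarith
  let Φ : ((P × ℝ) →ᵇ E) → ((P × ℝ) →ᵇ E) := fun Y =>
    BoundedContinuousFunction.ofNormedAddCommGroup
      (fun q : P × ℝ => Real.exp (-(k * |q.2|)) • ∫ r in (0:ℝ)..q.2, G Y q.1 r)
      (by have := hint Y; fun_prop) ((C + L * ‖Y‖) / k) (fun q => by
        rw [norm_smul, Real.norm_of_nonneg (Real.exp_pos _).le]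
        have := aux_bound (G Y q.1) (C + L * ‖Y‖) k hkpos (by positivity) (hGb Y q.1) q.2
        calc _ ≤ Real.exp (-(k * |q.2|)) * ((C + L * ‖Y‖) * Real.exp (k * |q.2|) / k) := by gcongr
          _ = (Real.exp (-(k * |q.2|)) * Real.exp (k * |q.2|)) * ((C + L * ‖Y‖) / k) := by ring
          _ = _ := by rw [← Real.exp_add]; simp)
  have hΦ : ContractingWith (1/2) Φ := by
    refine ⟨by rw [← NNReal.coe_lt_coe]; norm_num, LipschitzWith.of_dist_le_mul fun Y Y' => ?_⟩
    rw [BoundedContinuousFunction.dist_le (by positivity)]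
    intro q
    rw [dist_eq_norm, dist_eq_norm]
    change ‖Real.exp (-(k * |q.2|)) • (∫ r in (0:ℝ)..q.2, G Y q.1 r) -
      Real.exp (-(k * |q.2|)) • ∫ r in (0:ℝ)..q.2, G Y' q.1 r‖ ≤ _
    have hcont : ∀ Y, Continuous (G Y q.1) := fun Y =>
      (hGc Y).comp (by fun_prop : Continuous fun r : ℝ => (q.1, r))
    rw [← smul_sub, ← intervalIntegral.integral_sub ((hcont Y).intervalIntegrable _ _)
      ((hcont Y').intervalIntegrable _ _),
      norm_smul, Real.norm_of_nonneg (Real.exp_pos _).le]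
    have := aux_bound (fun r => G Y q.1 r - G Y' q.1 r) (L * ‖Y - Y'‖) k hkpos
      (by positivity) (hGd Y Y' q.1) q.2
    calc _ ≤ Real.exp (-(k * |q.2|)) * ((L * ‖Y - Y'‖) * Real.exp (k * |q.2|) / k) := by gcongr
      _ = (Real.exp (-(k * |q.2|)) * Real.exp (k * |q.2|)) * ((L / k) * ‖Y - Y'‖) := by ring
      _ = (L / k) * ‖Y - Y'‖ := by rw [← Real.exp_add]; simp
      _ ≤ (1/2) * ‖Y - Y'‖ := by gcongr
      _ = _ := by simp
  obtain ⟨Y, hY⟩ : ∃ Y, Φ Y = Y := ⟨_, hΦ.fixedPoint_isFixedPt⟩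
  have hYY : ∀ p s, Real.exp (k * |s|) • Y (p, s) = ∫ r in (0:ℝ)..s, G Y p r := fun p s => by
    have : Y (p, s) = Real.exp (-(k * |s|)) • ∫ r in (0:ℝ)..s, G Y p r := by
      conv_lhs => rw [← hY]
      rfl
    rw [this, smul_smul, ← Real.exp_add]; simp
  refine ⟨fun p s => Real.exp (k * |s|) • Y (p, s), ?_, ?_, ?_⟩
  · have := Y.continuous
    fun_prop
  · intro p
    exact (hYY p 0).trans (by simp)
  · intro p s
    have hcont : Continuous (G Y p) :=
      (hGc Y).comp (by fun_prop : Continuous fun r : ℝ => (p, r))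
    have h1 := intervalIntegral.integral_hasDerivAt_right (hcont.intervalIntegrable 0 s)
      hcont.aestronglyMeasurable.stronglyMeasurableAtFilter hcont.continuousAt
    have h2 : (fun s => Real.exp (k * |s|) • Y (p, s)) = fun s => ∫ r in (0:ℝ)..s, G Y p r :=
      funext (hYY p)
    rw [← h2] at h1
    exact h1

theorem ode_unique {E : Type*} [NormedAddCommGroup E] [NormedSpace ℝ E]
    (v : ℝ → E → E) (L : ℝ) (hL : 0 ≤ L)
    (hlip : ∀ r x y, ‖v r x - v r y‖ ≤ L * ‖x - y‖) (f g : ℝ → E)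
    (hf : ∀ s, HasDerivAt f (v s (f s)) s) (hg : ∀ s, HasDerivAt g (v s (g s)) s)
    (t : ℝ) (h : f t = g t) : f = g := by
  have hv : ∀ t, LipschitzOnWith (⟨L, hL⟩ : NNReal) (v t) univ := fun t =>
    (LipschitzWith.of_dist_le_mul fun x y => by
      rw [dist_eq_norm, dist_eq_norm]; exact hlip t x y).lipschitzOnWith
  exact ODE_solution_unique_univ (s := fun _ => univ) hv (fun s => ⟨hf s, mem_univ _⟩)
    (fun s => ⟨hg s, mem_univ _⟩) h

theorem flow_exists {E : Type*} [NormedAddCommGroup E] [NormedSpace ℝ E] [CompleteSpace E]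
    [LocallyCompactSpace E]
    (v : ℝ → E → E) (hv : Continuous fun q : ℝ × E => v q.1 q.2)
    (C L : ℝ) (hC : 0 ≤ C) (hL : 0 ≤ L) (hb : ∀ r x, ‖v r x‖ ≤ C)
    (hlip : ∀ r x y, ‖v r x - v r y‖ ≤ L * ‖x - y‖) :
    ∃ X : ℝ → E → ℝ → E, (Continuous fun q : ℝ × E × ℝ => X q.1 q.2.1 q.2.2) ∧
      (∀ t x, X t x t = x) ∧ ∀ t x s, HasDerivAt (X t x) (v s (X t x s)) s := by
  obtain ⟨Z, hZc, hZ0, hZ⟩ := volterra (P := ℝ × E) (E := E)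
    (fun p r z => v (p.1 + r) (p.2 + z))
    (hv.comp (by fun_prop : Continuous fun q : (ℝ × E) × ℝ × E => (q.1.1 + q.2.1, q.1.2 + q.2.2)))
    C L hC hL (fun p r => hb _ _) (fun p r x y => by
      have := hlip (p.1 + r) (p.2 + x) (p.2 + y)
      simpa using this)
  refine ⟨fun t x s => x + Z (t, x) (s - t), ?_, ?_, ?_⟩
  · have := hZc.comp (by fun_prop : Continuous fun q : ℝ × E × ℝ => ((q.1, q.2.1), q.2.2 - q.1))
    exact (by fun_prop : Continuous fun q : ℝ × E × ℝ => q.2.1).add this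
  · intro t x; simp [hZ0]
  · intro t x s
    have h1 := (hZ (t, x) (s - t)).comp_sub_const s t
    have h2 := h1.const_add x
    simpa using h2

theorem lin_exists {P E : Type*} [TopologicalSpace P] [FirstCountableTopology P]
    [LocallyCompactSpace P] [NormedAddCommGroup E] [NormedSpace ℝ E] [CompleteSpace E]
    (M : P → ℝ → E →L[ℝ] E) (hM : Continuous fun q : P × ℝ => M q.1 q.2)
    (L : ℝ) (hL : 0 ≤ L) (hb : ∀ p r, ‖M p r‖ ≤ L) :
    ∃ J : P → ℝ → E →L[ℝ] E, (Continuous fun q : P × ℝ => J q.1 q.2) ∧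
      (∀ p, J p 0 = ContinuousLinearMap.id ℝ E) ∧
      ∀ p s, HasDerivAt (J p) ((M p s).comp (J p s)) s := by
  obtain ⟨Z, hZc, hZ0, hZ⟩ := volterra (P := P) (E := E →L[ℝ] E)
    (fun p r z => (M p r).comp (ContinuousLinearMap.id ℝ E + z))
    (by
      have h1 := hM.comp (by fun_prop : Continuous fun q : P × ℝ × (E →L[ℝ] E) => (q.1, q.2.1))
      exact h1.clm_comp (by fun_prop))
    L L hL hL (fun p r => by simpa using hb p r) (fun p r x y => by
      rw [← ContinuousLinearMap.comp_sub, add_sub_add_left_eq_sub]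
      refine (ContinuousLinearMap.opNorm_comp_le _ _).trans ?_
      gcongr
      exact hb p r)
  refine ⟨fun p s => ContinuousLinearMap.id ℝ E + Z p s, continuous_const.add hZc, ?_, ?_⟩
  · intro p; simp [hZ0]
  · intro p s
    exact (hZ p s).const_add _

/-- Hadamard -/
theorem hadamard {E : Type*} [NormedAddCommGroup E] [NormedSpace ℝ E] [CompleteSpace E]
    (f : E → E) (D : E → E →L[ℝ] E) (hD : Continuous D) (hf : ∀ x, HasFDerivAt f (D x) x)
    (a b : E) : f b - f a = (∫ l in (0:ℝ)..1, D (a + l • (b - a))) (b - a) := by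
  have hc : Continuous fun l : ℝ => D (a + l • (b - a)) := by fun_prop
  rw [ContinuousLinearMap.intervalIntegral_apply (hc.intervalIntegrable _ _)]
  have := intervalIntegral.integral_eq_sub_of_hasDerivAt (a := 0) (b := 1)
    (f := fun l : ℝ => f (a + l • (b - a))) (f' := fun l : ℝ => D (a + l • (b - a)) (b - a))
    (fun l _ => by
      have h1 : HasDerivAt (fun l : ℝ => a + l • (b - a)) (b - a) l := by
        simpa using ((hasDerivAt_id l).smul_const (b - a)).const_add a
      exact (hf _).comp_hasDerivAt l h1)
    ((hc.clm_apply continuous_const).intervalIntegrable _ _)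
  rw [this]; simp

theorem strict_of_factor {E F : Type*} [NormedAddCommGroup E] [NormedSpace ℝ E]
    [NormedAddCommGroup F] [NormedSpace ℝ F]
    (f : E → F) (N : E × E → E →L[ℝ] F) (hN : Continuous N)
    (h : ∀ p p', f p - f p' = N (p, p') (p - p')) (x : E) : HasFDerivAt f (N (x, x)) x := by
  apply HasStrictFDerivAt.hasFDerivAt
  apply HasStrictFDerivAt.of_isLittleO
  rw [Asymptotics.isLittleO_iff]
  intro c hc
  have h1 : ∀ᶠ q in nhds (x, x), ‖N q - N (x, x)‖ < c := by
    have := (hN.tendsto (x, x)).eventually (Metric.ball_mem_nhds _ hc)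
    simpa [dist_eq_norm] using this
  filter_upwards [h1] with q hq
  rw [h q.1 q.2, ← sub_apply]
  exact (ContinuousLinearMap.le_opNorm _ _).trans (by gcongr)

theorem flow_diff {E : Type*} [NormedAddCommGroup E] [NormedSpace ℝ E] [CompleteSpace E]
    [LocallyCompactSpace E]
    (v : ℝ → E → E) (hv : Continuous fun q : ℝ × E => v q.1 q.2)
    (D : ℝ → E → E →L[ℝ] E) (hD : Continuous fun q : ℝ × E => D q.1 q.2)
    (hvD : ∀ t x, HasFDerivAt (v t) (D t x) x)
    (C L : ℝ) (hC : 0 ≤ C) (hL : 0 ≤ L) (hb : ∀ r x, ‖v r x‖ ≤ C) (hDb : ∀ r x, ‖D r x‖ ≤ L)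
    (hlip : ∀ r x y, ‖v r x - v r y‖ ≤ L * ‖x - y‖) :
    ∃ (ψ : ℝ × E → E) (Q : ℝ × E → E →L[ℝ] E), Continuous Q ∧ (∀ x, ψ (0, x) = x) ∧
      ∀ p : ℝ × E, HasFDerivAt ψ ((Q p).comp (ContinuousLinearMap.snd ℝ ℝ E -
        (ContinuousLinearMap.fst ℝ ℝ E).smulRight (v p.1 p.2))) p := by
  obtain ⟨X, hXc, hX0, hX⟩ := flow_exists v hv C L hC hL hb hlip
  have hXs : ∀ t x, Continuous (X t x) := fun t x =>
    hXc.comp (by fun_prop : Continuous fun s : ℝ => (t, x, s))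
  -- averaged derivative along two trajectories
  let M : ℝ × E × E → ℝ → E →L[ℝ] E := fun q s =>
    ∫ l in (0:ℝ)..1, D (q.1 + s) (X q.1 q.2.1 (q.1 + s) +
      l • (X q.1 q.2.2 (q.1 + s) - X q.1 q.2.1 (q.1 + s)))
  have hMc : Continuous fun q : (ℝ × E × E) × ℝ => M q.1 q.2 := by
    apply intervalIntegral.continuous_parametric_intervalIntegral_of_continuous'
    have h1 : Continuous fun z : ((ℝ × E × E) × ℝ) × ℝ =>
        X z.1.1.1 z.1.1.2.1 (z.1.1.1 + z.1.2) :=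
      hXc.comp (by fun_prop : Continuous fun z : ((ℝ × E × E) × ℝ) × ℝ =>
        (z.1.1.1, z.1.1.2.1, z.1.1.1 + z.1.2))
    have h2 : Continuous fun z : ((ℝ × E × E) × ℝ) × ℝ =>
        X z.1.1.1 z.1.1.2.2 (z.1.1.1 + z.1.2) :=
      hXc.comp (by fun_prop : Continuous fun z : ((ℝ × E × E) × ℝ) × ℝ =>
        (z.1.1.1, z.1.1.2.2, z.1.1.1 + z.1.2))
    exact hD.comp (by fun_prop : Continuous fun z : ((ℝ × E × E) × ℝ) × ℝ =>
      (z.1.1.1 + z.1.2, X z.1.1.1 z.1.1.2.1 (z.1.1.1 + z.1.2) +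
      z.2 • (X z.1.1.1 z.1.1.2.2 (z.1.1.1 + z.1.2) - X z.1.1.1 z.1.1.2.1 (z.1.1.1 + z.1.2))))
  have hMb : ∀ q s, ‖M q s‖ ≤ L := fun q s => by
    have := intervalIntegral.norm_integral_le_of_norm_le_const (a := (0:ℝ)) (b := 1) (C := L)
      (f := fun l : ℝ => D (q.1 + s) (X q.1 q.2.1 (q.1 + s) +
      l • (X q.1 q.2.2 (q.1 + s) - X q.1 q.2.1 (q.1 + s)))) (fun l _ => hDb _ _)
    simpa using this
  obtain ⟨J, hJc, hJ0, hJ⟩ := lin_exists M hMc L hL hMb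
  have key : ∀ t x y s, X t y (t + s) - X t x (t + s) = J (t, x, y) s (y - x) := by
    intro t x y s
    have := ode_unique (fun s w => M (t, x, y) s w) L hL (fun r a b => by
      rw [← map_sub]
      exact ((M (t, x, y) r).le_opNorm _).trans (by gcongr; exact hMb _ _))
      (fun s => X t y (t + s) - X t x (t + s)) (fun s => J (t, x, y) s (y - x))
      (fun s => by
        have h1 := (hX t y (t + s)).comp_const_add t s
        have h2 := (hX t x (t + s)).comp_const_add t s
        have h3 := h1.sub h2
        have h4 := hadamard (v (t + s)) (D (t + s))
          (hD.comp (by fun_prop : Continuous fun x : E => (t + s, x))) (hvD (t + s))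
          (X t x (t + s)) (X t y (t + s))
        rw [h4] at h3
        exact h3)
      (fun s => by
        have h1 := (hJ (t, x, y) s).clm_apply (hasDerivAt_const s (y - x))
        simpa using h1)
      0 (by simp [hX0, hJ0])
    exact congrFun this s
  have semi : ∀ t t' x s, X t (X t' x t) s = X t' x s := by
    intro t t' x s
    exact congrFun (ode_unique v L hL hlip _ _ (hX t (X t' x t)) (hX t' x) t (hX0 _ _)) s
  -- averaged velocity
  let V : (ℝ × E) × ℝ → E := fun q =>
    ∫ l in (0:ℝ)..1, v (q.1.1 + l * (q.2 - q.1.1)) (X q.1.1 q.1.2 (q.1.1 + l * (q.2 - q.1.1)))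
  have hVc : Continuous V := by
    apply intervalIntegral.continuous_parametric_intervalIntegral_of_continuous'
    have h1 : Continuous fun z : ((ℝ × E) × ℝ) × ℝ =>
        X z.1.1.1 z.1.1.2 (z.1.1.1 + z.2 * (z.1.2 - z.1.1.1)) :=
      hXc.comp (by fun_prop : Continuous fun z : ((ℝ × E) × ℝ) × ℝ =>
        (z.1.1.1, z.1.1.2, z.1.1.1 + z.2 * (z.1.2 - z.1.1.1)))
    exact hv.comp (by fun_prop : Continuous fun z : ((ℝ × E) × ℝ) × ℝ =>
      (z.1.1.1 + z.2 * (z.1.2 - z.1.1.1), X z.1.1.1 z.1.1.2 (z.1.1.1 + z.2 * (z.1.2 - z.1.1.1))))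
  have hV : ∀ t' x t, X t' x t - x = (t - t') • V ((t', x), t) := by
    intro t' x t
    have hc : Continuous fun l : ℝ => v (t' + l * (t - t')) (X t' x (t' + l * (t - t'))) := by
      have := hXs t' x
      exact hv.comp (by fun_prop : Continuous fun l : ℝ =>
        (t' + l * (t - t'), X t' x (t' + l * (t - t'))))
    have := intervalIntegral.integral_eq_sub_of_hasDerivAt (a := 0) (b := 1)
      (f := fun l : ℝ => X t' x (t' + l * (t - t')))
      (f' := fun l : ℝ => (t - t') • v (t' + l * (t - t')) (X t' x (t' + l * (t - t'))))
      (fun l _ => by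
        have h1 : HasDerivAt (fun l : ℝ => t' + l * (t - t')) (t - t') l := by
          simpa using ((hasDerivAt_id l).mul_const (t - t')).const_add t'
        exact (hX t' x (t' + l * (t - t'))).scomp l h1)
      ((hc.const_smul (t - t')).intervalIntegrable _ _)
    rw [intervalIntegral.integral_smul] at this
    simp [hX0] at this
    exact this.symm
  have hVd : ∀ t x, V ((t, x), t) = v t x := by
    intro t x
    simp [V, hX0]
  let N : (ℝ × E) × (ℝ × E) → (ℝ × E) →L[ℝ] E := fun q =>
    (J (q.1.1, X q.2.1 q.2.2 q.1.1, q.1.2) (-q.1.1)).comp (ContinuousLinearMap.snd ℝ ℝ E -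
        (ContinuousLinearMap.fst ℝ ℝ E).smulRight (V (q.2, q.1.1)))
  have hNc : Continuous N := by
    have h1 : Continuous fun q : (ℝ × E) × (ℝ × E) => X q.2.1 q.2.2 q.1.1 :=
      hXc.comp (by fun_prop : Continuous fun q : (ℝ × E) × (ℝ × E) => (q.2.1, q.2.2, q.1.1))
    have h2 : Continuous fun q : (ℝ × E) × (ℝ × E) =>
        J (q.1.1, X q.2.1 q.2.2 q.1.1, q.1.2) (-q.1.1) :=
      hJc.comp (by fun_prop : Continuous fun q : (ℝ × E) × (ℝ × E) =>
        ((q.1.1, X q.2.1 q.2.2 q.1.1, q.1.2), -q.1.1))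
    have h3 : Continuous fun q : (ℝ × E) × (ℝ × E) => V (q.2, q.1.1) :=
      hVc.comp (by fun_prop)
    refine h2.clm_comp (continuous_const.sub ?_)
    exact (ContinuousLinearMap.smulRightL ℝ (ℝ × E) E (ContinuousLinearMap.fst ℝ ℝ E)).continuous.comp h3
  refine ⟨fun p => X p.1 p.2 0, fun p => J (p.1, p.2, p.2) (-p.1), ?_, fun x => hX0 0 x, ?_⟩
  · exact hJc.comp (by fun_prop : Continuous fun p : ℝ × E => ((p.1, p.2, p.2), -p.1))
  · intro p
    have := strict_of_factor (fun p : ℝ × E => X p.1 p.2 0) N hNc (fun p p' => by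
      obtain ⟨t, y⟩ := p
      obtain ⟨t', x⟩ := p'
      have h1 := key t (X t' x t) y (-t)
      have h2 := hV t' x t
      simp only [add_neg_cancel, semi] at h1
      simp only [h1, N]
      have h3 : X t' x t = x + (t - t') • V ((t', x), t) := by rw [← h2]; simp
      simp only [ContinuousLinearMap.comp_apply]
      congr 1
      simp
      rw [h3]; abel) p
    simpa [N, hX0, hVd] using this

theorem cutoff (u1 u2 : ℝ × ℝ × ℝ → ℝ)
    (hu1c : Continuous u1) (hu2c : Continuous u2)
    (hu1x : ∀ t : ℝ, ContDiff ℝ 1 (fun y : ℝ × ℝ => u1 (t, y)))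
    (hu2x : ∀ t : ℝ, ContDiff ℝ 1 (fun y : ℝ × ℝ => u2 (t, y)))
    (hu1d : Continuous (sd1 u1) ∧ Continuous (sd2 u1))
    (hu2d : Continuous (sd1 u2) ∧ Continuous (sd2 u2)) (ρ : ℝ) (hρ : 0 < ρ) :
    ∃ (v : ℝ → ℝ × ℝ → ℝ × ℝ) (D : ℝ → ℝ × ℝ → (ℝ × ℝ) →L[ℝ] (ℝ × ℝ)) (C L : ℝ),
      (Continuous fun q : ℝ × ℝ × ℝ => v q.1 q.2) ∧ (Continuous fun q : ℝ × ℝ × ℝ => D q.1 q.2) ∧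
      (∀ t x, HasFDerivAt (v t) (D t x) x) ∧ 0 ≤ C ∧ 0 ≤ L ∧ (∀ r x, ‖v r x‖ ≤ C) ∧
      (∀ r x, ‖D r x‖ ≤ L) ∧ (∀ r x y, ‖v r x - v r y‖ ≤ L * ‖x - y‖) ∧
      (∀ p : ℝ × ℝ × ℝ, ‖p‖ ≤ ρ → v p.1 p.2 = (u1 p, u2 p)) := by
  let χ : ContDiffBump (0 : ℝ × ℝ × ℝ) := ⟨ρ, ρ + 1, hρ, by linarith⟩
  have hχ : ContDiff ℝ 1 χ := χ.contDiff
  have hχs : HasCompactSupport χ := χ.hasCompactSupport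
  let U : ℝ × ℝ × ℝ → ℝ × ℝ := fun p => (u1 p, u2 p)
  have hUc : Continuous U := hu1c.prodMk hu2c
  let DU : (ℝ × ℝ × ℝ → ℝ) → ℝ × ℝ × ℝ → (ℝ × ℝ) →L[ℝ] ℝ := fun f p =>
    sd1 f p • ContinuousLinearMap.fst ℝ ℝ ℝ + sd2 f p • ContinuousLinearMap.snd ℝ ℝ ℝ
  have hDU : ∀ f : ℝ × ℝ × ℝ → ℝ, (∀ t : ℝ, ContDiff ℝ 1 (fun y : ℝ × ℝ => f (t, y))) →
      ∀ t x, HasFDerivAt (fun y : ℝ × ℝ => f (t, y)) (DU f (t, x)) x := by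
    intro f hf t x
    have h1 := ((hf t).differentiable (by norm_num) x).hasFDerivAt
    convert! h1 using 1
    ext <;> simp [DU, sd1, sd2]
  have hDUc : ∀ f : ℝ × ℝ × ℝ → ℝ, Continuous (sd1 f) ∧ Continuous (sd2 f) →
      Continuous (DU f) := by
    intro f hf
    have h1 := hf.1
    have h2 := hf.2
    fun_prop
  let V : ℝ × ℝ × ℝ → ℝ × ℝ := fun p => χ p • U p
  let W : ℝ × ℝ × ℝ → (ℝ × ℝ) →L[ℝ] (ℝ × ℝ) := fun p =>
    χ p • ((DU u1 p).prod (DU u2 p)) +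
      ((fderiv ℝ χ p).comp (ContinuousLinearMap.inr ℝ ℝ (ℝ × ℝ))).smulRight (U p)
  have hVc : Continuous V := hχ.continuous.smul hUc
  have hVs : HasCompactSupport V := hχs.smul_right
  have hfc : Continuous (fderiv ℝ χ) := hχ.continuous_fderiv (by norm_num)
  have hWc : Continuous W := by
    have h1 := hDUc u1 hu1d
    have h2 := hDUc u2 hu2d
    have h3 : Continuous fun p => (DU u1 p).prod (DU u2 p) :=
      (ContinuousLinearMap.prodₗᵢ (𝕜 := ℝ) (E := ℝ × ℝ) (F := ℝ) (G := ℝ) ℝ).continuous.comp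
        (h1.prodMk h2)
    have h4 : Continuous fun p => (fderiv ℝ χ p).comp (ContinuousLinearMap.inr ℝ ℝ (ℝ × ℝ)) :=
      hfc.clm_comp continuous_const
    have h5 : Continuous fun p =>
        ((fderiv ℝ χ p).comp (ContinuousLinearMap.inr ℝ ℝ (ℝ × ℝ))).smulRight (U p) :=
      ((ContinuousLinearMap.smulRightL ℝ (ℝ × ℝ) (ℝ × ℝ)).continuous.comp h4).clm_apply hUc
    exact (hχ.continuous.smul h3).add h5
  have hWs : HasCompactSupport W := by
    have h1 : HasCompactSupport (fderiv ℝ χ) := hχs.fderiv (𝕜 := ℝ)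
    refine HasCompactSupport.add (f := fun p => χ p • ((DU u1 p).prod (DU u2 p))) hχs.smul_right ?_
    refine h1.mono fun p hp => ?_
    rw [Function.mem_support] at hp ⊢
    intro h
    apply hp
    ext <;> simp [h]
  obtain ⟨C, hC⟩ := hVc.bounded_above_of_compact_support hVs
  obtain ⟨L, hL⟩ := hWc.bounded_above_of_compact_support hWs
  have hC0 : 0 ≤ C := (norm_nonneg _).trans (hC 0)
  have hL0 : 0 ≤ L := (norm_nonneg _).trans (hL 0)
  have hder : ∀ t x, HasFDerivAt (fun y => V (t, y)) (W (t, x)) x := by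
    intro t x
    have h1 := (hDU u1 hu1x t x).prodMk (hDU u2 hu2x t x)
    have h2 : HasFDerivAt (fun y : ℝ × ℝ => χ (t, y))
        ((fderiv ℝ χ (t, x)).comp (ContinuousLinearMap.inr ℝ ℝ (ℝ × ℝ))) x :=
      ((hχ.differentiable (by norm_num) (t, x)).hasFDerivAt).comp x (hasFDerivAt_prodMk_right t x)
    exact h2.smul h1
  refine ⟨fun t x => V (t, x), fun t x => W (t, x), C, L, hVc, hWc, hder, hC0, hL0,
    fun r x => hC _, fun r x => hL _, ?_, ?_⟩
  · intro r x y
    exact Convex.norm_image_sub_le_of_norm_hasFDerivWithin_le (s := univ) (𝕜 := ℝ)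
      (fun z _ => (hder r z).hasFDerivWithinAt) (fun z _ => hL (r, z)) convex_univ
      (mem_univ _) (mem_univ _)
  · intro p hp
    have : χ p = 1 := χ.one_of_mem_closedBall (by simpa [χ] using hp)
    simp [V, this, U]

theorem hasDerivAt_min_sq (y : ℝ) : HasDerivAt (fun y : ℝ => (min y 0) ^ 2) (2 * min y 0) y := by
  rw [hasDerivAt_iff_isLittleO]
  have h : (fun z : ℝ => (min z 0) ^ 2 - (min y 0) ^ 2 - (z - y) • (2 * min y 0)) =O[nhds y]
      fun z => (z - y) ^ 2 := by
    apply Asymptotics.IsBigO.of_bound 1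
    refine Filter.Eventually.of_forall fun z => ?_
    simp only [Real.norm_eq_abs, smul_eq_mul, one_mul]
    rw [abs_of_nonneg (sq_nonneg (z - y)), abs_le]
    rcases le_total y 0 with h1 | h1 <;> rcases le_total z 0 with h2 | h2 <;>
      simp only [h1, h2, min_eq_left, min_eq_right] <;> constructor <;> nlinarith
  refine h.trans_isLittleO ?_
  have := Asymptotics.isLittleO_pow_sub_sub y (m := 2) (by norm_num)
  simpa using this

theorem barrier (y y' : ℝ → ℝ) (c : ℝ) (hy : ∀ s, HasDerivAt y (y' s) s)
    (h : ∀ s, y s ≤ c → y' s = 0) (t : ℝ) (ht : c ≤ y t) (s : ℝ) : c ≤ y s := by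
  have h1 : ∀ s, HasDerivAt (fun s => (min (y s - c) 0) ^ 2) 0 s := by
    intro s
    have h2 := (hasDerivAt_min_sq (y s - c)).comp s ((hy s).sub_const c)
    have h3 : 2 * min (y s - c) 0 * y' s = 0 := by
      rcases le_total (y s) c with h4 | h4
      · rw [h s h4, mul_zero]
      · rw [min_eq_right (by linarith)]; simp
    rw [h3] at h2
    exact h2
  have h5 := is_const_of_deriv_eq_zero (fun s => (h1 s).differentiableAt)
    (fun s => (h1 s).deriv) s t
  rw [min_eq_right (by linarith : 0 ≤ y t - c)] at h5
  have h6 : min (y s - c) 0 = 0 := by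
    apply pow_eq_zero_iff (n := 2) (by norm_num) |>.1
    rw [h5]; norm_num
  have := min_eq_right_iff.1 h6
  linarith

def cl (a b z : ℝ) : ℝ := max a (min b z)

theorem cl_lip (a b x y : ℝ) : |cl a b x - cl a b y| ≤ |x - y| := by
  unfold cl
  refine (abs_max_sub_max_le_max a _ a _).trans ?_
  refine max_le (by simp) ((abs_min_sub_min_le_max b x b y).trans (max_le (by simp) le_rfl))

theorem cl_mem (a b z : ℝ) (h : a ≤ b) : cl a b z ∈ Icc a b :=
  ⟨le_max_left _ _, max_le h (min_le_left _ _)⟩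

theorem cl_of_mem (a b z : ℝ) (h : z ∈ Icc a b) : cl a b z = z := by
  unfold cl; rw [min_eq_right h.2, max_eq_right h.1]

theorem cl_of_le (a b z : ℝ) (hab : a ≤ b) (h : z ≤ a) : cl a b z = a := by
  unfold cl; rw [min_eq_right (h.trans hab), max_eq_left h]

theorem cl_of_ge (a b z : ℝ) (hab : a ≤ b) (h : b ≤ z) : cl a b z = b := by
  unfold cl; rw [min_eq_left h, max_eq_right hab]

theorem cl_cont (a b : ℝ) : Continuous (cl a b) := by unfold cl; fun_prop

theorem traj_exists (T R : ℝ) (hT : 0 < T) (hR : 0 < R) (u1 u2 : ℝ × ℝ × ℝ → ℝ)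
    (v : ℝ → ℝ × ℝ → ℝ × ℝ) (C L : ℝ) (hv : Continuous fun q : ℝ × ℝ × ℝ => v q.1 q.2)
    (hC : 0 ≤ C) (hL : 0 ≤ L) (hb : ∀ r x, ‖v r x‖ ≤ C)
    (hlip : ∀ r x y, ‖v r x - v r y‖ ≤ L * ‖x - y‖)
    (hvu : ∀ p ∈ (Icc (0 : ℝ) T) ×ˢ OmegaR R, v p.1 p.2 = (u1 p, u2 p))
    (hbc : ∀ t ∈ Icc (0 : ℝ) T, ∀ x₁ ∈ Icc (-R) R,
      u2 (t, x₁, 0) = 0 ∧ u2 (t, x₁, 1) = 0)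
    (hlat : ∀ t ∈ Icc (0 : ℝ) T, ∀ x₂ ∈ Icc (0 : ℝ) 1,
      u1 (t, -R, x₂) = 0 ∧ u1 (t, R, x₂) = 0 ∧ u2 (t, -R, x₂) = 0 ∧ u2 (t, R, x₂) = 0)
    (t : ℝ) (x : ℝ × ℝ) (hx : x ∈ OmegaR R) :
    ∃ Y : ℝ → ℝ × ℝ, Y t = x ∧ (∀ s, Y s ∈ OmegaR R) ∧
      ∀ s ∈ Icc 0 T, HasDerivAt Y (u1 (s, Y s), u2 (s, Y s)) s := by
  have hRR : -R ≤ R := by linarith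
  let π : ℝ × ℝ → ℝ × ℝ := fun x => (cl (-R) R x.1, cl 0 1 x.2)
  have hπ : ∀ x, π x ∈ OmegaR R := fun x => ⟨cl_mem _ _ _ hRR, cl_mem _ _ _ zero_le_one⟩
  have hπc : Continuous π :=
    ((cl_cont _ _).comp continuous_fst).prodMk ((cl_cont _ _).comp continuous_snd)
  have hπl : ∀ x y, ‖π x - π y‖ ≤ ‖x - y‖ := fun x y => by
    rw [Prod.norm_def, Prod.norm_def]
    exact max_le_max (cl_lip _ _ _ _) (cl_lip _ _ _ _)
  let w : ℝ → ℝ × ℝ → ℝ × ℝ := fun s x => v (cl 0 T s) (π x)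
  have hcT : ∀ s, cl 0 T s ∈ Icc 0 T := fun s => cl_mem _ _ _ hT.le
  have hw : ∀ s x, w s x = (u1 (cl 0 T s, π x), u2 (cl 0 T s, π x)) := fun s x =>
    hvu (cl 0 T s, π x) ⟨hcT s, hπ x⟩
  obtain ⟨X, -, hX0, hX⟩ := flow_exists w
    (hv.comp (((cl_cont 0 T).comp continuous_fst).prodMk (hπc.comp continuous_snd)))
    C L hC hL (fun _ _ => hb _ _) (fun r x y => (hlip _ _ _).trans (by gcongr; exact hπl x y))
  have h1 : ∀ s, HasDerivAt (fun s => (X t x s).1) (u1 (cl 0 T s, π (X t x s))) s := fun s => by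
    have := hX t x s
    rw [hw] at this
    exact this.fst
  have h2 : ∀ s, HasDerivAt (fun s => (X t x s).2) (u2 (cl 0 T s, π (X t x s))) s := fun s => by
    have := hX t x s
    rw [hw] at this
    exact this.snd
  have hx' : X t x t ∈ OmegaR R := by rw [hX0]; exact hx
  have hmem : ∀ s, X t x s ∈ OmegaR R := fun s => by
    refine ⟨⟨?_, ?_⟩, ?_, ?_⟩
    · refine barrier _ _ (-R) h1 (fun r hr => ?_) t hx'.1.1 s
      have := (hlat _ (hcT r) _ (hπ (X t x r)).2).1
      simp only [π] at this ⊢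
      rwa [cl_of_le _ _ _ hRR hr]
    · refine neg_le_neg_iff.1 (barrier _ _ (-R) (fun r => (h1 r).neg) (fun r hr => ?_) t
        (neg_le_neg hx'.1.2) s)
      have := (hlat _ (hcT r) _ (hπ (X t x r)).2).2.1
      simp only [π] at this ⊢
      rwa [cl_of_ge _ _ _ hRR (neg_le_neg_iff.1 hr), neg_eq_zero]
    · refine barrier _ _ 0 h2 (fun r hr => ?_) t hx'.2.1 s
      have := (hbc _ (hcT r) _ (hπ (X t x r)).1).1
      simp only [π] at this ⊢
      rwa [cl_of_le _ _ _ zero_le_one hr]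
    · refine neg_le_neg_iff.1 (barrier _ _ (-1) (fun r => (h2 r).neg) (fun r hr => ?_) t
        (neg_le_neg hx'.2.2) s)
      have := (hbc _ (hcT r) _ (hπ (X t x r)).1).2
      simp only [π] at this ⊢
      rwa [cl_of_ge _ _ _ zero_le_one (neg_le_neg_iff.1 hr), neg_eq_zero]
  refine ⟨X t x, hX0 t x, hmem, fun s hs => ?_⟩
  have h3 := hX t x s
  have h4 : π (X t x s) = X t x s :=
    Prod.ext (cl_of_mem _ _ _ (hmem s).1) (cl_of_mem _ _ _ (hmem s).2)
  rw [hw, h4, cl_of_mem _ _ _ hs] at h3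
  exact h3

theorem partials (θ : ℝ × ℝ × ℝ → ℝ) (A : (ℝ × ℝ × ℝ) →L[ℝ] ℝ) (p : ℝ × ℝ × ℝ)
    (h : HasFDerivAt θ A p) : td θ p = A (1, 0) ∧ sd1 θ p = A (0, 1, 0) ∧ sd2 θ p = A (0, 0, 1) := by
  obtain ⟨t, x⟩ := p
  have h1 : HasDerivAt (fun s : ℝ => θ (s, x)) (A (1, 0)) t :=
    h.comp_hasDerivAt (f := fun s : ℝ => (s, x)) t ((hasDerivAt_id t).prodMk (hasDerivAt_const t x))
  have h2 : HasFDerivAt (fun y : ℝ × ℝ => θ (t, y))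
      (A.comp (ContinuousLinearMap.inr ℝ ℝ (ℝ × ℝ))) x :=
    h.comp x (hasFDerivAt_prodMk_right t x)
  refine ⟨h1.deriv, ?_, ?_⟩
  · simp only [sd1]; rw [h2.fderiv]; simp
  · simp only [sd2]; rw [h2.fderiv]; simp

theorem transport_const (T R : ℝ) (u1 u2 : ℝ × ℝ × ℝ → ℝ) (θ : ℝ × ℝ × ℝ → ℝ)
    (hθ : ContDiff ℝ 1 θ)
    (hpde : ∀ p ∈ (Icc (0 : ℝ) T) ×ˢ OmegaR R, td θ p + u1 p * sd1 θ p + u2 p * sd2 θ p = 0)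
    (Y : ℝ → ℝ × ℝ) (hY : ∀ s, Y s ∈ OmegaR R)
    (hYd : ∀ s ∈ Icc 0 T, HasDerivAt Y (u1 (s, Y s), u2 (s, Y s)) s)
    (t : ℝ) (ht : t ∈ Icc 0 T) : θ (t, Y t) = θ (0, Y 0) := by
  have hd : ∀ s ∈ Icc 0 T, HasDerivAt (fun s => θ (s, Y s)) 0 s := by
    intro s hs
    have h1 := (hθ.differentiable (by norm_num) (s, Y s)).hasFDerivAt
    obtain ⟨e1, e2, e3⟩ := partials θ _ _ h1
    have h2 := h1.comp_hasDerivAt (f := fun s : ℝ => (s, Y s)) s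
      ((hasDerivAt_id s).prodMk (hYd s hs))
    have h3 := hpde (s, Y s) ⟨hs, hY s⟩
    rw [e1, e2, e3, ← smul_eq_mul, ← smul_eq_mul, ← map_smul, ← map_smul, ← map_add, ← map_add] at h3
    convert! h2 using 1
    rw [← h3]
    congr 1
    simp
  have hc : ContinuousOn (fun s => θ (s, Y s)) (Icc 0 T) := fun s hs =>
    (hd s hs).continuousAt.continuousWithinAt
  exact constant_of_has_deriv_right_zero hc
    (fun s hs => (hd s (Ico_subset_Icc_self hs)).hasDerivWithinAt) t ht

/-- Well-posedness of the transport equation by the method of characteristics. -/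
theorem transport_wellposed (T R : ℝ) (hT : 0 < T) (hR : 0 < R)
    (u1 u2 : ℝ × ℝ × ℝ → ℝ)
    -- u is continuous with continuous spatial partial derivatives
    (hu1c : Continuous u1) (hu2c : Continuous u2)
    (hu1x : ∀ t : ℝ, ContDiff ℝ 1 (fun y : ℝ × ℝ => u1 (t, y)))
    (hu2x : ∀ t : ℝ, ContDiff ℝ 1 (fun y : ℝ × ℝ => u2 (t, y)))
    (hu1d : Continuous (sd1 u1) ∧ Continuous (sd2 u1))
    (hu2d : Continuous (sd1 u2) ∧ Continuous (sd2 u2))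
    -- incompressibility on [0,T] × Ω_R
    (hdiv : ∀ p ∈ (Icc (0 : ℝ) T) ×ˢ OmegaR R, sd1 u1 p + sd2 u2 p = 0)
    -- boundary conditions: no flux through the top and bottom
    (hbc : ∀ t ∈ Icc (0 : ℝ) T, ∀ x₁ ∈ Icc (-R) R,
      u2 (t, x₁, 0) = 0 ∧ u2 (t, x₁, 1) = 0)
    -- zero boundary values on the lateral sides
    (hlat : ∀ t ∈ Icc (0 : ℝ) T, ∀ x₂ ∈ Icc (0 : ℝ) 1,
      u1 (t, -R, x₂) = 0 ∧ u1 (t, R, x₂) = 0 ∧ u2 (t, -R, x₂) = 0 ∧ u2 (t, R, x₂) = 0)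
    -- continuously differentiable initial datum
    (θ₀ : ℝ × ℝ → ℝ) (hθ₀ : ContDiff ℝ 1 θ₀) :
    ∃ θ : ℝ × ℝ × ℝ → ℝ, ContDiff ℝ 1 θ ∧
      (∀ p ∈ (Icc (0 : ℝ) T) ×ˢ OmegaR R,
        td θ p + u1 p * sd1 θ p + u2 p * sd2 θ p = 0) ∧
      (∀ x ∈ OmegaR R, θ (0, x) = θ₀ x) ∧
      (∀ θ' : ℝ × ℝ × ℝ → ℝ, ContDiff ℝ 1 θ' →
        (∀ p ∈ (Icc (0 : ℝ) T) ×ˢ OmegaR R,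
          td θ' p + u1 p * sd1 θ' p + u2 p * sd2 θ' p = 0) →
        (∀ x ∈ OmegaR R, θ' (0, x) = θ₀ x) →
        ∀ p ∈ (Icc (0 : ℝ) T) ×ˢ OmegaR R, θ' p = θ p) := by
  obtain ⟨v, D, C, L, hvc, hDc, hvD, hC, hL, hb, hDb, hlip, hvu⟩ :=
    cutoff u1 u2 hu1c hu2c hu1x hu2x hu1d hu2d (T + R + 1) (by linarith)
  have hvu' : ∀ p ∈ (Icc (0 : ℝ) T) ×ˢ OmegaR R, v p.1 p.2 = (u1 p, u2 p) := by
    rintro ⟨t, x, y⟩ ⟨⟨h1, h2⟩, ⟨h3, h4⟩, h5, h6⟩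
    apply hvu
    simp only at h1 h2 h3 h4 h5 h6
    simp only [Prod.norm_def, Real.norm_eq_abs]
    refine max_le ?_ (max_le ?_ ?_) <;> rw [abs_le] <;> constructor <;> linarith
  obtain ⟨ψ, Q, hQ, hψ0, hψ⟩ := flow_diff v hvc D hDc hvD C L hC hL hb hDb hlip
  have hψ1 : ContDiff ℝ 1 ψ := by
    rw [contDiff_one_iff_hasFDerivAt]
    refine ⟨_, ?_, hψ⟩
    refine hQ.clm_comp (continuous_const.sub ?_)
    exact (ContinuousLinearMap.smulRightL ℝ (ℝ × ℝ × ℝ) (ℝ × ℝ)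
      (ContinuousLinearMap.fst ℝ ℝ (ℝ × ℝ))).continuous.comp hvc
  have hθ : ContDiff ℝ 1 (fun p => θ₀ (ψ p)) := hθ₀.comp hψ1
  have hpde : ∀ p ∈ (Icc (0 : ℝ) T) ×ˢ OmegaR R,
      td (fun p => θ₀ (ψ p)) p + u1 p * sd1 (fun p => θ₀ (ψ p)) p +
        u2 p * sd2 (fun p => θ₀ (ψ p)) p = 0 := by
    intro p hp
    have h1 := ((hθ₀.differentiable (by norm_num) (ψ p)).hasFDerivAt).comp p (hψ p)
    obtain ⟨e1, e2, e3⟩ := partials (fun p => θ₀ (ψ p)) _ _ h1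
    rw [e1, e2, e3, ← smul_eq_mul, ← smul_eq_mul, ← map_smul, ← map_smul, ← map_add, ← map_add]
    simp [hvu' p hp]
  refine ⟨fun p => θ₀ (ψ p), hθ, hpde, fun x _ => by simp only [hψ0], ?_⟩
  rintro θ' hθ' hpde' h0' ⟨t, x⟩ ⟨ht, hx⟩
  obtain ⟨Y, hYt, hYm, hYd⟩ := traj_exists T R hT hR u1 u2 v C L hvc hC hL hb hlip hvu' hbc hlat
    t x hx
  have a1 := transport_const T R u1 u2 θ' hθ' hpde' Y hYm hYd t ht
  have a2 := transport_const T R u1 u2 _ hθ hpde Y hYm hYd t ht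
  rw [hYt] at a1 a2
  rw [a1, h0' _ (hYm 0)]
  simp only at a2 ⊢
  rw [a2, hψ0]
end
end

section
/- Uniqueness for the linearized perturbed problem on the strip: suppose (v,π,Θ), with v = (v₁,v₂), is a classical solution on [0,T]×Ω_∞ of the linearized system ∂_t v + ∇π = μΔv + Θ·(0,g), ∂_tΘ + v₂·Dθ̄ = 0, ∂₁v₁ + ∂₂v₂ = 0 (v continuous together with its first time derivative and first and second spatial derivatives, π and Θ continuously differentiable), satisfying the Navier boundary conditions v₂(t,x₁,0) = v₂(t,x₁,1) = 0, ∂₂v₁(t,x₁,1) = (k₁/μ)·v₁(t,x₁,1), ∂₂v₁(t,x₁,0) = −(k₀/μ)·v₁(t,x₁,0) for all x₁ ∈ ℝ. Assume in addition that for every t ∈ [0,T] the functions v(t,·), ∇v(t,·), Θ(t,·), π(t,·) and ∇π(t,·) are square integrable on Ω_∞, and that t ↦ v(t,·) and t ↦ Θ(t,·) are continuously differentiable as maps from [0,T] into L²(Ω_∞), with derivatives given by the pointwise time derivatives ∂_t v and ∂_tΘ. If v(0,·) = 0 and Θ(0,·) = 0, then v ≡ 0 and Θ ≡ 0 on [0,T]×Ω_∞.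 -/
open MeasureTheory Set Filter Topology

noncomputable section

/-- the infinite strip `Ω_∞ = ℝ × [0,1]` -/
def Strip : Set (ℝ × ℝ) := (univ : Set ℝ) ×ˢ (Icc (0 : ℝ) 1)

/-- square integrability on the strip at each time in `[0,T]` -/
def SqIntOn (T : ℝ) (f : ℝ × ℝ × ℝ → ℝ) : Prop :=
  ∀ t ∈ Icc (0 : ℝ) T, IntegrableOn (fun x : ℝ × ℝ => (f (t, x)) ^ 2) Strip

/-- `t ↦ f(t,·)` is continuously differentiable as a map from `[0,T]` into
`L²(Ω_∞)`, with derivative given by the pointwise time derivative. -/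
def C1IntoL2 (T : ℝ) (f : ℝ × ℝ × ℝ → ℝ) : Prop :=
  (∀ t ∈ Icc (0 : ℝ) T,
    Tendsto (fun h : ℝ =>
        ∫ x in Strip, ((f (t + h, x) - f (t, x)) / h - td f (t, x)) ^ 2)
      (𝓝[{h : ℝ | t + h ∈ Icc (0 : ℝ) T ∧ h ≠ 0}] 0) (𝓝 0)) ∧
  (∀ t₀ ∈ Icc (0 : ℝ) T,
    Tendsto (fun t : ℝ => ∫ x in Strip, (td f (t, x) - td f (t₀, x)) ^ 2)
      (𝓝[Icc (0 : ℝ) T] t₀) (𝓝 0))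


/-- linear form with coefficients `a`, `b` -/
def linF (a b : ℝ) : ℝ × ℝ →L[ℝ] ℝ :=
  a • ContinuousLinearMap.fst ℝ ℝ ℝ + b • ContinuousLinearMap.snd ℝ ℝ ℝ

lemma linF_10 (a b : ℝ) : linF a b (1, 0) = a := by simp [linF]
lemma linF_01 (a b : ℝ) : linF a b (0, 1) = b := by simp [linF]

lemma linF_eq (l : ℝ × ℝ →L[ℝ] ℝ) : linF (l (1, 0)) (l (0, 1)) = l := by
  ext <;> simp [linF]

/-- `f` has gradient `(a,b)` at `p` -/
def PDat (f : ℝ × ℝ → ℝ) (a b : ℝ) (p : ℝ × ℝ) : Prop := HasFDerivAt f (linF a b) p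

lemma PDat.mk' {f : ℝ × ℝ → ℝ} {a b : ℝ} {p : ℝ × ℝ} {l : ℝ × ℝ →L[ℝ] ℝ}
    (h : HasFDerivAt f l p) (ha : l (1, 0) = a) (hb : l (0, 1) = b) : PDat f a b p := by
  subst ha hb
  unfold PDat
  rw [linF_eq]
  exact h

lemma PDat.congr {f : ℝ × ℝ → ℝ} {a b a' b' : ℝ} {p : ℝ × ℝ} (h : PDat f a b p)
    (ha : a = a') (hb : b = b') : PDat f a' b' p := by subst ha hb; exact h

lemma PDat.add {f g : ℝ × ℝ → ℝ} {a b c d : ℝ} {p : ℝ × ℝ} (hf : PDat f a b p)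
    (hg : PDat g c d p) : PDat (fun x => f x + g x) (a + c) (b + d) p := by
  have := HasFDerivAt.add hf hg
  exact PDat.mk' this (by simp [linF]; try ring) (by simp [linF]; try ring)

lemma PDat.sub {f g : ℝ × ℝ → ℝ} {a b c d : ℝ} {p : ℝ × ℝ} (hf : PDat f a b p)
    (hg : PDat g c d p) : PDat (fun x => f x - g x) (a - c) (b - d) p := by
  have := HasFDerivAt.sub hf hg
  exact PDat.mk' this (by simp [linF]; try ring) (by simp [linF]; try ring)

lemma PDat.mul {f g : ℝ × ℝ → ℝ} {a b c d : ℝ} {p : ℝ × ℝ} (hf : PDat f a b p)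
    (hg : PDat g c d p) :
    PDat (fun x => f x * g x) (f p * c + a * g p) (f p * d + b * g p) p := by
  have := HasFDerivAt.mul hf hg
  exact PDat.mk' this (by simp [linF]; try ring) (by simp [linF]; try ring)

lemma PDat.cmul {f : ℝ × ℝ → ℝ} {a b : ℝ} {p : ℝ × ℝ} (c : ℝ) (hf : PDat f a b p) :
    PDat (fun x => c * f x) (c * a) (c * b) p := by
  have := HasFDerivAt.const_mul hf c
  exact PDat.mk' this (by simp [linF]; try ring) (by simp [linF]; try ring)

lemma PDat.fst {f : ℝ → ℝ} {a : ℝ} {p : ℝ × ℝ} (h : HasDerivAt f a p.1) :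
    PDat (fun x => f x.1) a 0 p := by
  have := h.hasFDerivAt.comp p (hasFDerivAt_fst (𝕜 := ℝ) (p := p))
  exact PDat.mk' this (by simp [linF]; try ring) (by simp [linF]; try ring)

lemma PDat.d1 {f : ℝ × ℝ → ℝ} {a b : ℝ} {p : ℝ × ℝ} (h : PDat f a b p) :
    HasDerivAt (fun x => f (x, p.2)) a p.1 := by
  have h2 : HasDerivAt (fun x : ℝ => (x, p.2)) ((1 : ℝ), (0 : ℝ)) p.1 :=
    (hasDerivAt_id p.1).prodMk (hasDerivAt_const p.1 p.2)
  have h' : HasFDerivAt f (linF a b) (p.1, p.2) := h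
  have := h'.comp_hasDerivAt p.1 h2
  rw [linF_10] at this
  exact this

lemma PDat.d2 {f : ℝ × ℝ → ℝ} {a b : ℝ} {p : ℝ × ℝ} (h : PDat f a b p) :
    HasDerivAt (fun y => f (p.1, y)) b p.2 := by
  have h2 : HasDerivAt (fun y : ℝ => (p.1, y)) ((0 : ℝ), (1 : ℝ)) p.2 :=
    (hasDerivAt_const p.2 p.1).prodMk (hasDerivAt_id p.2)
  have h' : HasFDerivAt f (linF a b) (p.1, p.2) := h
  have := h'.comp_hasDerivAt p.2 h2
  rw [linF_01] at this
  exact this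

lemma PDat.of_partials {f a b : ℝ × ℝ → ℝ} {p : ℝ × ℝ}
    (ha : ContinuousAt a p) (hb : ContinuousAt b p)
    (h1 : ∀ᶠ q in 𝓝 p, HasDerivAt (fun x => f (x, q.2)) (a q) q.1)
    (h2 : ∀ᶠ q in 𝓝 p, HasDerivAt (fun y => f (q.1, y)) (b q) q.2) : PDat f (a p) (b p) p := by
  have := hasStrictFDerivAt_uncurry_coprod (𝕜 := ℝ) (u := p) (f := fun x y => f (x, y))
    (f₁ := fun x y => ContinuousLinearMap.toSpanSingleton ℝ (a (x, y)))
    (f₂ := fun x y => ContinuousLinearMap.toSpanSingleton ℝ (b (x, y)))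
    (h1.mono fun q hq => hq.hasFDerivAt) (h2.mono fun q hq => hq.hasFDerivAt)
    (by
      have : Continuous (fun r : ℝ => ContinuousLinearMap.toSpanSingleton ℝ r) :=
        (ContinuousLinearMap.toSpanSingletonCLE (𝕜 := ℝ) (E := ℝ)).continuous
      exact this.continuousAt.comp ha)
    (by
      have : Continuous (fun r : ℝ => ContinuousLinearMap.toSpanSingleton ℝ r) :=
        (ContinuousLinearMap.toSpanSingletonCLE (𝕜 := ℝ) (E := ℝ)).continuous
      exact this.continuousAt.comp hb)
  have h3 := this.hasFDerivAt
  exact PDat.mk' h3 (by simp [linF, Function.HasUncurry.uncurry]; try ring) (by simp [linF, Function.HasUncurry.uncurry]; try ring)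

lemma hasDerivAt_setIntegral_compact {Y : Type*} [TopologicalSpace Y] [MeasurableSpace Y]
    [OpensMeasurableSpace Y] [SecondCountableTopology Y] [T2Space Y] {ν : Measure Y}
    [IsLocallyFiniteMeasure ν]
    {K : Set Y} (hK : IsCompact K) {F F' : ℝ → Y → ℝ}
    (hF : Continuous (Function.uncurry F)) (hF' : Continuous (Function.uncurry F'))
    (hd : ∀ t y, HasDerivAt (fun s => F s y) (F' t y) t) (t : ℝ) :
    HasDerivAt (fun s => ∫ y in K, F s y ∂ν) (∫ y in K, F' t y ∂ν) t := by
  obtain ⟨M, hM⟩ := ((isCompact_closedBall t 1).prod hK).bddAbove_image hF'.norm.continuousOn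
  refine (hasDerivAt_integral_of_dominated_loc_of_deriv_le (F := F) (F' := F')
    (bound := fun _ => M) (s := Metric.ball t 1) (Metric.ball_mem_nhds t one_pos) ?_ ?_ ?_ ?_ ?_ ?_).2
  · filter_upwards with x using Continuous.aestronglyMeasurable (by fun_prop)
  · exact (Continuous.continuousOn (by fun_prop)).integrableOn_compact hK
  · exact Continuous.aestronglyMeasurable (by fun_prop)
  · filter_upwards [ae_restrict_mem hK.measurableSet] with y hy x hx
    exact hM (mem_image_of_mem _ (mk_mem_prod (Metric.ball_subset_closedBall hx) hy))
  · exact integrableOn_const hK.measure_ne_top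
  · filter_upwards with y x _ using hd x y

lemma hasDerivAt_intervalIntegral_param {F F' : ℝ → ℝ → ℝ} (a b : ℝ)
    (hF : Continuous (Function.uncurry F)) (hF' : Continuous (Function.uncurry F'))
    (hd : ∀ t y, HasDerivAt (fun s => F s y) (F' t y) t) (t : ℝ) :
    HasDerivAt (fun s => ∫ y in a..b, F s y) (∫ y in a..b, F' t y) t := by
  rcases le_total a b with h | h
  · simp only [intervalIntegral.integral_of_le h, ← integral_Icc_eq_integral_Ioc]
    exact hasDerivAt_setIntegral_compact isCompact_Icc hF hF' hd t
  · simp only [intervalIntegral.integral_of_ge h, ← integral_Icc_eq_integral_Ioc]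
    exact (hasDerivAt_setIntegral_compact isCompact_Icc hF hF' hd t).neg

/-- time primitive -/
def TI (t0 : ℝ) (f : ℝ × ℝ × ℝ → ℝ) (p : ℝ × ℝ × ℝ) : ℝ := ∫ s in t0..p.1, f (s, p.2)

lemma TI_cont (t0 : ℝ) {f : ℝ × ℝ × ℝ → ℝ} (hf : Continuous f) : Continuous (TI t0 f) := by
  unfold TI
  exact intervalIntegral.continuous_parametric_intervalIntegral_of_continuous
    (f := fun (p : ℝ × ℝ × ℝ) s => f (s, p.2)) (by fun_prop) (by fun_prop)

lemma TI_dt (t0 : ℝ) {f : ℝ × ℝ × ℝ → ℝ} (hf : Continuous f) (t : ℝ) (y : ℝ × ℝ) :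
    HasDerivAt (fun s => TI t0 f (s, y)) (f (t, y)) t := by
  have h : Continuous (fun s => f (s, y)) := by fun_prop
  exact intervalIntegral.integral_hasDerivAt_right (h.intervalIntegrable _ _)
    (h.stronglyMeasurableAtFilter _ _) h.continuousAt

lemma TI_PD (t0 : ℝ) {f a b : ℝ × ℝ × ℝ → ℝ} (hf : Continuous f) (ha : Continuous a)
    (hb : Continuous b) (h : ∀ t y, PDat (fun y => f (t, y)) (a (t, y)) (b (t, y)) y)
    (t : ℝ) (y : ℝ × ℝ) :
    PDat (fun y => TI t0 f (t, y)) (TI t0 a (t, y)) (TI t0 b (t, y)) y := by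
  have ca := TI_cont t0 ha
  have cb := TI_cont t0 hb
  refine PDat.of_partials (f := fun y => TI t0 f (t, y)) (a := fun y => TI t0 a (t, y))
    (b := fun y => TI t0 b (t, y)) (by fun_prop) (by fun_prop) ?_ ?_
  · filter_upwards with q
    exact hasDerivAt_intervalIntegral_param (F := fun x s => f (s, x, q.2))
      (F' := fun x s => a (s, x, q.2)) t0 t (by fun_prop) (by fun_prop)
      (fun x s => (h s (x, q.2)).d1) q.1
  · filter_upwards with q
    exact hasDerivAt_intervalIntegral_param (F := fun x s => f (s, q.1, x))
      (F' := fun x s => b (s, q.1, x)) t0 t (by fun_prop) (by fun_prop)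
      (fun x s => (h s (q.1, x)).d2) q.2

/-- box -/
def Bx (L : ℝ) : Set (ℝ × ℝ) := Icc (-L) L ×ˢ Icc (0 : ℝ) 1

lemma Bx_compact (L : ℝ) : IsCompact (Bx L) := isCompact_Icc.prod isCompact_Icc
lemma Bx_meas (L : ℝ) : MeasurableSet (Bx L) := (Bx_compact L).measurableSet
lemma Bx_sub (L : ℝ) : Bx L ⊆ Strip := prod_mono (subset_univ _) subset_rfl
lemma Bx_int {f : ℝ × ℝ → ℝ} (L : ℝ) (hf : Continuous f) : IntegrableOn f (Bx L) :=
  hf.continuousOn.integrableOn_compact (Bx_compact L)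

/-- vertical primitive -/
def PS (f : ℝ × ℝ → ℝ) (p : ℝ × ℝ) : ℝ := ∫ s in (0 : ℝ)..p.2, f (p.1, s)

lemma PS_cont {f : ℝ × ℝ → ℝ} (hf : Continuous f) : Continuous (PS f) := by
  unfold PS
  exact intervalIntegral.continuous_parametric_intervalIntegral_of_continuous
    (f := fun (p : ℝ × ℝ) s => f (p.1, s)) (by fun_prop) (by fun_prop)

lemma cs_aux {f : ℝ → ℝ} (hf : Continuous f) {y : ℝ} (hy : y ∈ Icc (0 : ℝ) 1) :
    (∫ s in (0 : ℝ)..y, f s) ^ 2 ≤ ∫ s in (0 : ℝ)..1, f s ^ 2 := by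
  set c := ∫ s in (0 : ℝ)..y, f s with hc
  have h0 : 0 ≤ ∫ s in (0 : ℝ)..y, (f s - c) ^ 2 :=
    intervalIntegral.integral_nonneg hy.1 (fun s _ => sq_nonneg _)
  have h1 : ∫ s in (0 : ℝ)..y, (f s - c) ^ 2
      = (∫ s in (0 : ℝ)..y, f s ^ 2) - 2 * c * c + y * c ^ 2 := by
    have : ∀ s, (f s - c) ^ 2 = f s ^ 2 - 2 * c * f s + c ^ 2 := fun s => by ring
    simp only [this]
    rw [intervalIntegral.integral_add, intervalIntegral.integral_sub,
      intervalIntegral.integral_const_mul, intervalIntegral.integral_const, ← hc]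
    · simp
    all_goals exact Continuous.intervalIntegrable (by fun_prop) _ _
  have h2 : ∫ s in (0 : ℝ)..1, f s ^ 2
      = (∫ s in (0 : ℝ)..y, f s ^ 2) + ∫ s in y..1, f s ^ 2 := by
    rw [intervalIntegral.integral_add_adjacent_intervals]
    all_goals exact Continuous.intervalIntegrable (by fun_prop) _ _
  have h3 : 0 ≤ ∫ s in y..1, f s ^ 2 :=
    intervalIntegral.integral_nonneg hy.2 (fun s _ => sq_nonneg _)
  nlinarith [hy.2, sq_nonneg c]

lemma Bx_fubini {f : ℝ × ℝ → ℝ} (L : ℝ) (hf : Continuous f) :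
    ∫ p in Bx L, f p = ∫ x in Icc (-L) L, ∫ y in Icc (0 : ℝ) 1, f (x, y) :=
  setIntegral_prod f (Bx_int L hf)

lemma PS_sq_le {f : ℝ × ℝ → ℝ} (L : ℝ) (hf : Continuous f) :
    ∫ p in Bx L, PS f p ^ 2 ≤ ∫ p in Bx L, f p ^ 2 := by
  have hP := PS_cont hf
  rw [Bx_fubini L (by fun_prop), Bx_fubini L (by fun_prop)]
  have c1 : Continuous fun x => ∫ y in Icc (0 : ℝ) 1, PS f (x, y) ^ 2 :=
    continuous_parametric_integral_of_continuous (f := fun x y => PS f (x, y) ^ 2)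
      (by fun_prop) isCompact_Icc
  have c2 : Continuous fun x => ∫ y in Icc (0 : ℝ) 1, f (x, y) ^ 2 :=
    continuous_parametric_integral_of_continuous (f := fun x y => f (x, y) ^ 2)
      (by fun_prop) isCompact_Icc
  refine setIntegral_mono_on c1.integrableOn_Icc c2.integrableOn_Icc measurableSet_Icc ?_
  intro x _
  have : ∀ y ∈ Icc (0 : ℝ) 1, PS f (x, y) ^ 2 ≤ ∫ s in (0 : ℝ)..1, f (x, s) ^ 2 :=
    fun y hy => cs_aux (f := fun s => f (x, s)) (by fun_prop) hy
  calc ∫ y in Icc (0 : ℝ) 1, PS f (x, y) ^ 2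
      ≤ ∫ y in Icc (0 : ℝ) 1, ∫ s in (0 : ℝ)..1, f (x, s) ^ 2 := by
        refine setIntegral_mono_on (Continuous.integrableOn_Icc (by fun_prop))
          (Continuous.integrableOn_Icc (by fun_prop)) measurableSet_Icc this
    _ = ∫ s in (0 : ℝ)..1, f (x, s) ^ 2 := by simp
    _ = _ := by
      rw [intervalIntegral.integral_of_le zero_le_one, integral_Icc_eq_integral_Ioc]

lemma PS_d2 {f : ℝ × ℝ → ℝ} (hf : Continuous f) (p : ℝ × ℝ) :
    HasDerivAt (fun y => PS f (p.1, y)) (f p) p.2 := by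
  have h : Continuous (fun s => f (p.1, s)) := by fun_prop
  exact intervalIntegral.integral_hasDerivAt_right (h.intervalIntegrable _ _)
    (h.stronglyMeasurableAtFilter _ _) h.continuousAt

lemma PS_d1 {V1 V2 V11 V12 V21 V22 : ℝ × ℝ → ℝ} (c1 : Continuous V1) (c11 : Continuous V11)
    (c22 : Continuous V22)
    (h1 : ∀ p, PDat V1 (V11 p) (V12 p) p) (h2 : ∀ p, PDat V2 (V21 p) (V22 p) p)
    (hdiv : ∀ p ∈ Strip, V11 p + V22 p = 0) (hb : ∀ x, V2 (x, 0) = 0)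
    (p : ℝ × ℝ) (hp : p ∈ Strip) :
    HasDerivAt (fun x => PS V1 (x, p.2)) (-V2 p) p.1 := by
  have := hasDerivAt_intervalIntegral_param (F := fun x s => V1 (x, s))
    (F' := fun x s => V11 (x, s)) 0 p.2 (by fun_prop) (by fun_prop)
    (fun x s => (h1 (x, s)).d1) p.1
  have e : ∫ y in (0 : ℝ)..p.2, V11 (p.1, y) = - V2 p := by
    have e1 : ∫ y in (0 : ℝ)..p.2, V11 (p.1, y) = ∫ y in (0 : ℝ)..p.2, - V22 (p.1, y) := by
      refine intervalIntegral.integral_congr ?_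
      intro y hy
      rw [uIcc_of_le hp.2.1] at hy
      have := hdiv (p.1, y) ⟨mem_univ _, hy.1, hy.2.trans hp.2.2⟩
      simp only
      linarith
    rw [e1, intervalIntegral.integral_neg,
      intervalIntegral.integral_eq_sub_of_hasDerivAt (f := fun y => V2 (p.1, y))
        (fun y _ => (h2 (p.1, y)).d2) (Continuous.intervalIntegrable (by fun_prop) _ _), hb]
    simp
  rw [e] at this
  exact this

lemma PS_PD {V1 V2 V11 V12 V21 V22 : ℝ × ℝ → ℝ} (c1 : Continuous V1) (c2 : Continuous V2)
    (c11 : Continuous V11) (c22 : Continuous V22)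
    (h1 : ∀ p, PDat V1 (V11 p) (V12 p) p) (h2 : ∀ p, PDat V2 (V21 p) (V22 p) p)
    (hdiv : ∀ p ∈ Strip, V11 p + V22 p = 0) (hb : ∀ x, V2 (x, 0) = 0)
    (p : ℝ × ℝ) (hp : p.2 ∈ Ioo (0 : ℝ) 1) :
    PDat (PS V1) (-V2 p) (V1 p) p := by
  refine PDat.of_partials (a := fun p => -V2 p) (b := V1) (by fun_prop) (by fun_prop) ?_ ?_
  · have : ∀ᶠ q : ℝ × ℝ in 𝓝 p, q.2 ∈ Ioo (0 : ℝ) 1 :=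
      continuousAt_snd.eventually (isOpen_Ioo.mem_nhds hp)
    filter_upwards [this] with q hq
    exact PS_d1 c1 c11 c22 h1 h2 hdiv hb q ⟨mem_univ _, hq.1.le, hq.2.le⟩
  · filter_upwards with q
    exact PS_d2 c1 q

lemma flux_zero {V1 V2 V11 V12 V21 V22 : ℝ × ℝ → ℝ} (c1 : Continuous V1)
    (c11 : Continuous V11) (c22 : Continuous V22)
    (h1 : ∀ p, PDat V1 (V11 p) (V12 p) p) (h2 : ∀ p, PDat V2 (V21 p) (V22 p) p)
    (hdiv : ∀ p ∈ Strip, V11 p + V22 p = 0) (hb : ∀ x, V2 (x, 0) = 0) (hb1 : ∀ x, V2 (x, 1) = 0)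
    (B : ℝ) (hB : ∀ L, 1 ≤ L → ∫ p in Bx L, V1 p ^ 2 ≤ B) (x : ℝ) : PS V1 (x, 1) = 0 := by
  have hd : ∀ x, HasDerivAt (fun x => PS V1 (x, 1)) 0 x := by
    intro x
    have := PS_d1 c1 c11 c22 h1 h2 hdiv hb (x, 1) ⟨mem_univ _, by simp⟩
    rw [hb1] at this
    simpa using this
  have hc : ∀ z, PS V1 (z, 1) = PS V1 (x, 1) := fun z =>
    is_const_of_deriv_eq_zero (fun x => (hd x).differentiableAt) (fun x => (hd x).deriv) z x
  set c := PS V1 (x, 1)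
  have key : ∀ L, 1 ≤ L → 2 * L * c ^ 2 ≤ B := by
    intro L hL
    refine le_trans ?_ (hB L hL)
    rw [Bx_fubini L (by fun_prop)]
    have c2 : Continuous fun x => ∫ y in Icc (0 : ℝ) 1, V1 (x, y) ^ 2 :=
      continuous_parametric_integral_of_continuous (f := fun x y => V1 (x, y) ^ 2)
        (by fun_prop) isCompact_Icc
    have : ∫ x in Icc (-L) L, c ^ 2 ≤ ∫ x in Icc (-L) L, ∫ y in Icc (0 : ℝ) 1, V1 (x, y) ^ 2 := by
      refine setIntegral_mono_on (Continuous.integrableOn_Icc (by fun_prop))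
        c2.integrableOn_Icc measurableSet_Icc ?_
      intro z _
      rw [← hc z, integral_Icc_eq_integral_Ioc, ← intervalIntegral.integral_of_le zero_le_one]
      exact cs_aux (f := fun s => V1 (z, s)) (by fun_prop) (by simp)
    refine le_trans (le_of_eq ?_) this
    simp [max_eq_left (show (0:ℝ) ≤ L + L by linarith)]
    left; ring
  by_contra hne
  have hp : 0 < c ^ 2 := by positivity
  have h1 := key (max 1 (B / c ^ 2)) (le_max_left _ _)
  have h2 : B ≤ max 1 (B / c ^ 2) * c ^ 2 := by
    rw [← div_le_iff₀ hp]; exact le_max_right _ _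
  have h3 : 0 < max 1 (B / c ^ 2) * c ^ 2 := by
    have : (1:ℝ) ≤ max 1 (B / c ^ 2) := le_max_left _ _
    positivity
  linarith

/-- cutoff -/
def ph (L x : ℝ) : ℝ := (1 - (x / L) ^ 2) ^ 4
def ph1 (L x : ℝ) : ℝ := (1 - (x / L) ^ 2) ^ 2 * (-8 * (x / L) * (1 - (x / L) ^ 2) / L)
def ph2 (L x : ℝ) : ℝ :=
  (1 - (x / L) ^ 2) ^ 2 * ((-8 * (1 - (x / L) ^ 2) + 48 * (x / L) ^ 2) / L ^ 2)

lemma ph_cont (L : ℝ) : Continuous (ph L) := by unfold ph; fun_prop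
lemma ph1_cont (L : ℝ) : Continuous (ph1 L) := by unfold ph1; fun_prop
lemma ph2_cont (L : ℝ) : Continuous (ph2 L) := by unfold ph2; fun_prop

lemma ph_d (L x : ℝ) : HasDerivAt (ph L) (ph1 L x) x := by
  have h : HasDerivAt (fun x : ℝ => 1 - (x / L) ^ 2) (-(2 * (x / L) * (1 / L))) x := by
    have := (((hasDerivAt_id x).div_const L).pow 2).const_sub 1
    simpa using this
  have := h.pow 4
  convert! this using 1
  unfold ph1
  push_cast
  ring

lemma ph1_d (L x : ℝ) : HasDerivAt (ph1 L) (ph2 L x) x := by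
  have h0 : HasDerivAt (fun x : ℝ => x / L) (1 / L) x := (hasDerivAt_id x).div_const L
  have h : HasDerivAt (fun x : ℝ => 1 - (x / L) ^ 2) (-(2 * (x / L) * (1 / L))) x := by
    have := (h0.pow 2).const_sub 1
    simpa using this
  have := (h.pow 2).mul (((h0.const_mul (-8)).mul h).div_const L)
  convert! this using 1
  unfold ph2
  simp only [Pi.pow_apply, Pi.mul_apply]
  push_cast
  ring

lemma ph_bounds {L x : ℝ} (hL : 1 ≤ L) (hx : x ∈ Icc (-L) L) :
    ∃ χ e f : ℝ, 0 ≤ χ ∧ χ ≤ 1 ∧ ph L x = χ ^ 4 ∧ ph1 L x = χ ^ 2 * e ∧ ph2 L x = χ ^ 2 * f ∧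
      e ^ 2 ≤ 64 / L ∧ f ^ 2 ≤ 3136 / L ∧ |ph1 L x| ≤ 8 / L := by
  have hL0 : 0 < L := by linarith
  have hz : |x / L| ≤ 1 := by
    rw [abs_div, abs_of_pos hL0, div_le_one hL0]
    exact abs_le.2 hx
  have hz2 : (x / L) ^ 2 ≤ 1 := by
    rw [← sq_abs]; exact pow_le_one₀ (abs_nonneg _) hz
  have hz3 := sq_nonneg (x / L)
  have hLL : L ≤ L ^ 2 := by nlinarith
  have hLL4 : L ≤ L ^ 4 := by nlinarith [sq_nonneg (L ^ 2 - L)]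
  have he : |-8 * (x / L) * (1 - (x / L) ^ 2) / L| ≤ 8 / L := by
    rw [abs_div, abs_of_pos hL0, abs_mul, abs_mul]
    gcongr
    have : |1 - (x / L) ^ 2| ≤ 1 := by rw [abs_le]; constructor <;> linarith
    norm_num
    calc 8 * |x / L| * |1 - (x / L) ^ 2| ≤ 8 * 1 * 1 := by gcongr
      _ = 8 := by norm_num
  refine ⟨1 - (x / L) ^ 2, -8 * (x / L) * (1 - (x / L) ^ 2) / L,
    (-8 * (1 - (x / L) ^ 2) + 48 * (x / L) ^ 2) / L ^ 2, by linarith, by linarith, rfl, rfl, rfl,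
    ?_, ?_, ?_⟩
  · rw [← sq_abs]
    calc _ ≤ (8 / L) ^ 2 := by gcongr
      _ = 64 / L ^ 2 := by ring
      _ ≤ 64 / L := by gcongr
  · rw [div_pow, ← pow_mul]
    calc (-8 * (1 - (x / L) ^ 2) + 48 * (x / L) ^ 2) ^ 2 / L ^ (2 * 2) ≤ 3136 / L ^ 4 := by
          norm_num only
          gcongr
          nlinarith
      _ ≤ 3136 / L := by gcongr
  · unfold ph1
    rw [abs_mul]
    have : |(1 - (x / L) ^ 2) ^ 2| ≤ 1 := by
      rw [abs_of_nonneg (by positivity)]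
      exact pow_le_one₀ (by linarith) (by linarith)
    calc _ ≤ 1 * (8 / L) := by gcongr
      _ = _ := by ring

lemma ptwise {μ g L φ p1 p2 χ e f V1 V2 V11 V12 V21 V22 S a2 Q : ℝ} (hμ : 0 < μ) (hg : 0 < g)
    (hL : 1 ≤ L)
    (hφ : φ = χ ^ 4) (h1 : p1 = χ ^ 2 * e) (h2 : p2 = χ ^ 2 * f) (he : e ^ 2 ≤ 64 / L)
    (hf : f ^ 2 ≤ 3136 / L) (hp : |p1| ≤ 8 / L) (hd : V11 + V22 = 0) :
    - μ * ((p1 * V1 + φ * V11) * V11 + φ * V12 * V12 + (2 * (p1 * V2) + φ * V21 - p2 * S) * V21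
        + (φ * V22 - p1 * V1) * V22) + p1 * S * a2 - g * Q * (p1 * S)
      ≤ (1568 * μ + 8 + 8 * g) / L * (V1 ^ 2 + V2 ^ 2 + S ^ 2 + a2 ^ 2 + Q ^ 2) := by
  have A : - ((p1 * V1 + φ * V11) * V11 + φ * V12 * V12
      + (2 * (p1 * V2) + φ * V21 - p2 * S) * V21 + (φ * V22 - p1 * V1) * V22)
      ≤ 1568 / L * (V1 ^ 2 + V2 ^ 2 + S ^ 2) := by
    subst hφ h1 h2
    have s1 : e ^ 2 * V1 ^ 2 ≤ 64 / L * V1 ^ 2 := by gcongr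
    have s2 : e ^ 2 * V2 ^ 2 ≤ 64 / L * V2 ^ 2 := by gcongr
    have s3 : f ^ 2 * S ^ 2 ≤ 3136 / L * S ^ 2 := by gcongr
    have q1 := sq_nonneg (χ ^ 2 * V11 + e * V1 / 2)
    have q2 := sq_nonneg (χ ^ 2 * V12)
    have q3 := sq_nonneg (χ ^ 2 * V21 + (2 * e * V2 - f * S) / 2)
    have q4 := sq_nonneg (χ ^ 2 * V22 - e * V1 / 2)
    have q5 := sq_nonneg (2 * e * V2 + f * S)
    have d1 : 0 ≤ V1 ^ 2 / L := by positivity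
    have d2 : 0 ≤ V2 ^ 2 / L := by positivity
    have e1 : 64 / L * V1 ^ 2 = 64 * (V1 ^ 2 / L) := by ring
    have e2 : 64 / L * V2 ^ 2 = 64 * (V2 ^ 2 / L) := by ring
    have e3 : 3136 / L * S ^ 2 = 3136 * (S ^ 2 / L) := by ring
    have e4 : 1568 / L * (V1 ^ 2 + V2 ^ 2 + S ^ 2)
      = 1568 * (V1 ^ 2 / L) + 1568 * (V2 ^ 2 / L) + 1568 * (S ^ 2 / L) := by ring
    rw [e1] at s1; rw [e2] at s2; rw [e3] at s3; rw [e4]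
    nlinarith
  have B : p1 * S * a2 ≤ 8 / L * (S ^ 2 + a2 ^ 2) := by
    calc p1 * S * a2 ≤ |p1 * S * a2| := le_abs_self _
      _ = |p1| * (|S| * |a2|) := by rw [abs_mul, abs_mul]; ring
      _ ≤ 8 / L * (S ^ 2 + a2 ^ 2) := by
        gcongr
        nlinarith [sq_abs S, sq_abs a2, sq_nonneg (|S| - |a2|), sq_nonneg (|S| + |a2|)]
  have C : - (Q * (p1 * S)) ≤ 8 / L * (S ^ 2 + Q ^ 2) := by
    calc - (Q * (p1 * S)) ≤ |Q * (p1 * S)| := neg_le_abs _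
      _ = |p1| * (|S| * |Q|) := by rw [abs_mul, abs_mul]; ring
      _ ≤ 8 / L * (S ^ 2 + Q ^ 2) := by
        gcongr
        nlinarith [sq_abs S, sq_abs Q, sq_nonneg (|S| - |Q|), sq_nonneg (|S| + |Q|)]
  have A' := mul_le_mul_of_nonneg_left A hμ.le
  have C' := mul_le_mul_of_nonneg_left C hg.le
  have hL0 : 0 < L := by linarith
  have r1 : 0 ≤ μ / L * (a2 ^ 2 + Q ^ 2) := by positivity
  have r2 : 0 ≤ 1 / L * (V1 ^ 2 + V2 ^ 2 + Q ^ 2) := by positivity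
  have r3 : 0 ≤ g / L * (V1 ^ 2 + V2 ^ 2 + a2 ^ 2) := by positivity
  have key : (1568 * μ + 8 + 8 * g) / L * (V1 ^ 2 + V2 ^ 2 + S ^ 2 + a2 ^ 2 + Q ^ 2)
    = μ * (1568 / L * (V1 ^ 2 + V2 ^ 2 + S ^ 2)) + 8 / L * (S ^ 2 + a2 ^ 2)
      + g * (8 / L * (S ^ 2 + Q ^ 2)) + 1568 * (μ / L * (a2 ^ 2 + Q ^ 2))
      + 8 * (1 / L * (V1 ^ 2 + V2 ^ 2 + Q ^ 2))
      + 8 * (g / L * (V1 ^ 2 + V2 ^ 2 + a2 ^ 2)) := by ring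
  rw [key]
  linarith

lemma energy_space {μ g k0 k1 : ℝ} (hμ : 0 < μ) (hg : 0 < g) (hk0 : k0 ≤ 0) (hk1 : k1 ≤ 0)
    {V1 V2 V11 V12 V21 V22 A111 A112 A121 A122 A211 A212 A221 A222 P P1 P2 Q a1 a2 : ℝ × ℝ → ℝ}
    (c1 : Continuous V1) (c2 : Continuous V2)
    (c11 : Continuous V11) (c12 : Continuous V12) (c21 : Continuous V21) (c22 : Continuous V22)
    (cA111 : Continuous A111) (cA122 : Continuous A122)
    (cA211 : Continuous A211) (cA222 : Continuous A222)
    (cP : Continuous P) (cP1 : Continuous P1) (cP2 : Continuous P2) (cQ : Continuous Q)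
    (ca1 : Continuous a1) (ca2 : Continuous a2)
    (h1 : ∀ p, PDat V1 (V11 p) (V12 p) p) (h2 : ∀ p, PDat V2 (V21 p) (V22 p) p)
    (h11 : ∀ p, PDat V11 (A111 p) (A112 p) p) (h12 : ∀ p, PDat V12 (A121 p) (A122 p) p)
    (h21 : ∀ p, PDat V21 (A211 p) (A212 p) p) (h22 : ∀ p, PDat V22 (A221 p) (A222 p) p)
    (hP : ∀ p, PDat P (P1 p) (P2 p) p)
    (hdiv : ∀ p ∈ Strip, V11 p + V22 p = 0) (hb : ∀ x, V2 (x, 0) = 0) (hb1 : ∀ x, V2 (x, 1) = 0)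
    (hn1 : ∀ x, V12 (x, 1) = (k1 / μ) * V1 (x, 1)) (hn0 : ∀ x, V12 (x, 0) = -(k0 / μ) * V1 (x, 0))
    (he1 : ∀ p ∈ Strip, a1 p = μ * (A111 p + A122 p) - P1 p)
    (he2 : ∀ p ∈ Strip, a2 p = μ * (A211 p + A222 p) - P2 p + g * Q p)
    (B : ℝ) (hB : ∀ L, 1 ≤ L → ∫ p in Bx L, V1 p ^ 2 ≤ B) (L : ℝ) (hL : 1 ≤ L) :
    ∫ p in Bx L, ph L p.1 * (V1 p * a1 p + V2 p * a2 p) ≤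
      g * (∫ p in Bx L, ph L p.1 * (Q p * V2 p)) +
      (1568 * μ + 8 + 8 * g) / L *
        ∫ p in Bx L, (2 * V1 p ^ 2 + V2 p ^ 2 + a2 p ^ 2 + Q p ^ 2) := by
  have hL0 : 0 < L := by linarith
  have hfl := flux_zero c1 c11 c22 h1 h2 hdiv hb hb1 B hB
  have hS := PS_PD c1 c2 c11 c22 h1 h2 hdiv hb
  have cS := PS_cont c1
  have hS2 := PS_sq_le L c1
  set S := PS V1 with hSdef
  have hS0 : ∀ x, S (x, 0) = 0 := fun x => by simp [hSdef, PS]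
  have cph := ph_cont L
  have cph1 := ph1_cont L
  have cph2 := ph2_cont L
  have hphP : ∀ p : ℝ × ℝ, PDat (fun p : ℝ × ℝ => ph L p.1) (ph1 L p.1) 0 p :=
    fun p => PDat.fst (ph_d L p.1)
  have hph1P : ∀ p : ℝ × ℝ, PDat (fun p : ℝ × ℝ => ph1 L p.1) (ph2 L p.1) 0 p :=
    fun p => PDat.fst (ph1_d L p.1)
  have hBx : Bx L = Icc ((-L, 0) : ℝ × ℝ) (L, 1) := by rw [Icc_prod_eq]; rfl
  -- test field
  set w1 : ℝ × ℝ → ℝ := fun p => ph L p.1 * V1 p with hw1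
  set w2 : ℝ × ℝ → ℝ := fun p => ph L p.1 * V2 p - ph1 L p.1 * S p with hw2
  have cw1 : Continuous w1 := by fun_prop
  have cw2 : Continuous w2 := by fun_prop
  set w11 : ℝ × ℝ → ℝ := fun p => ph1 L p.1 * V1 p + ph L p.1 * V11 p with hw11
  set w12 : ℝ × ℝ → ℝ := fun p => ph L p.1 * V12 p with hw12
  set w21 : ℝ × ℝ → ℝ := fun p => 2 * (ph1 L p.1 * V2 p) + ph L p.1 * V21 p - ph2 L p.1 * S p
    with hw21
  set w22 : ℝ × ℝ → ℝ := fun p => ph L p.1 * V22 p - ph1 L p.1 * V1 p with hw22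
  have hw1P : ∀ p, PDat w1 (w11 p) (w12 p) p := fun p =>
    ((hphP p).mul (h1 p)).congr (by simp only [hw11]; ring) (by simp only [hw12]; ring)
  have hw2P : ∀ p : ℝ × ℝ, p.2 ∈ Ioo (0 : ℝ) 1 → PDat w2 (w21 p) (w22 p) p := fun p hp =>
    (((hphP p).mul (h2 p)).sub ((hph1P p).mul (hS p hp))).congr
      (by simp only [hw21]; ring) (by simp only [hw22]; ring)
  set F : ℝ × ℝ → ℝ := fun p => μ * (w1 p * V11 p + w2 p * V21 p) - P p * w1 p with hF
  set G : ℝ × ℝ → ℝ := fun p => μ * (w1 p * V12 p + w2 p * V22 p) - P p * w2 p with hG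
  set FX : ℝ × ℝ → ℝ := fun p => μ * ((w1 p * A111 p + w11 p * V11 p)
    + (w2 p * A211 p + w21 p * V21 p)) - (P p * w11 p + P1 p * w1 p) with hFX
  set GY : ℝ × ℝ → ℝ := fun p => μ * ((w1 p * A122 p + w12 p * V12 p)
    + (w2 p * A222 p + w22 p * V22 p)) - (P p * w22 p + P2 p * w2 p) with hGY
  have cF : Continuous F := by fun_prop
  have cG : Continuous G := by fun_prop
  have cFX : Continuous FX := by fun_prop
  have cGY : Continuous GY := by fun_prop
  have hdivthm := integral_divergence_prod_Icc_of_hasFDerivAt_of_le F G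
    (fun p => linF (FX p) (μ * ((w1 p * A112 p + w12 p * V11 p)
      + (w2 p * A212 p + w22 p * V21 p)) - (P p * w12 p + P2 p * w1 p)))
    (fun p => linF (μ * ((w1 p * A121 p + w11 p * V12 p)
      + (w2 p * A221 p + w21 p * V22 p)) - (P p * w21 p + P1 p * w2 p)) (GY p))
    (-L, 0) (L, 1) (by constructor <;> simp; linarith) cF.continuousOn cG.continuousOn
    (fun p hp => ((((hw1P p).mul (h11 p)).add ((hw2P p hp.2).mul (h21 p))).cmul μ).sub
      ((hP p).mul (hw1P p)))
    (fun p hp => ((((hw1P p).mul (h12 p)).add ((hw2P p hp.2).mul (h22 p))).cmul μ).sub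
      ((hP p).mul (hw2P p hp.2)))
    (by
      simp only [linF_10, linF_01]
      rw [← hBx]
      exact Bx_int L (cFX.add cGY))
  simp only [linF_10, linF_01] at hdivthm
  rw [← hBx] at hdivthm
  have phL : ph L L = 0 := by simp [ph, hL0.ne']
  have phL' : ph L (-L) = 0 := by simp [ph, hL0.ne']
  have ph1L : ph1 L L = 0 := by simp [ph1, hL0.ne']
  have ph1L' : ph1 L (-L) = 0 := by simp [ph1, hL0.ne']
  have b1 : ∀ y, F (L, y) = 0 := fun y => by simp [hF, hw1, hw2, phL, ph1L]
  have b2 : ∀ y, F (-L, y) = 0 := fun y => by simp [hF, hw1, hw2, phL', ph1L']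
  have b3 : ∀ x, G (x, 1) = k1 * (ph L x * V1 (x, 1) ^ 2) := fun x => by
    simp only [hG, hw1, hw2, hb1, hfl, hn1]
    field_simp
    ring
  have b4 : ∀ x, G (x, 0) = -k0 * (ph L x * V1 (x, 0) ^ 2) := fun x => by
    simp only [hG, hw1, hw2, hb, hS0, hn0]
    field_simp
    ring
  simp only [b1, b2, b3, b4, intervalIntegral.integral_zero,
    intervalIntegral.integral_const_mul] at hdivthm
  have phnn : ∀ x, 0 ≤ ph L x := fun x => by
    unfold ph
    have : (1 - (x / L) ^ 2) ^ 4 = ((1 - (x / L) ^ 2) ^ 2) ^ 2 := by ring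
    rw [this]; positivity
  have i1 : 0 ≤ ∫ x in (-L)..L, ph L x * V1 (x, 1) ^ 2 :=
    intervalIntegral.integral_nonneg (by linarith) fun x _ => mul_nonneg (phnn x) (sq_nonneg _)
  have i0 : 0 ≤ ∫ x in (-L)..L, ph L x * V1 (x, 0) ^ 2 :=
    intervalIntegral.integral_nonneg (by linarith) fun x _ => mul_nonneg (phnn x) (sq_nonneg _)
  have hneg : ∫ p in Bx L, (FX p + GY p) ≤ 0 := by
    rw [hdivthm]
    nlinarith [mul_nonneg (neg_nonneg.2 hk1) i1, mul_nonneg (neg_nonneg.2 hk0) i0]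
  set C := (1568 * μ + 8 + 8 * g) / L with hC
  have hC0 : 0 ≤ C := by positivity
  have main : ∫ p in Bx L, ph L p.1 * (V1 p * a1 p + V2 p * a2 p) ≤
      ∫ p in Bx L, ((FX p + GY p) + g * (ph L p.1 * (Q p * V2 p))
        + C * ((V1 p ^ 2 + V2 p ^ 2 + a2 p ^ 2 + Q p ^ 2) + S p ^ 2)) := by
    refine setIntegral_mono_on (Bx_int L (by fun_prop)) (Bx_int L (by fun_prop)) (Bx_meas L) ?_
    intro p hp
    obtain ⟨χ, e, f, -, -, q1, q2, q3, q4, q5, q6⟩ := ph_bounds hL hp.1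
    have hd := hdiv p (Bx_sub L hp)
    have hh := ptwise (V1 := V1 p) (V2 := V2 p) (V12 := V12 p) (V21 := V21 p)
      (S := S p) (a2 := a2 p) (Q := Q p) hμ hg hL q1 q2 q3 q4 q5 q6 hd
    have e1 := he1 p (Bx_sub L hp)
    have e2 := he2 p (Bx_sub L hp)
    rw [← hC] at hh
    have hV : V22 p = - V11 p := by linarith
    simp only [hFX, hGY, hw1, hw2, hw11, hw12, hw21, hw22]
    rw [show μ * (ph L p.1 * V1 p * A111 p + (ph1 L p.1 * V1 p + ph L p.1 * V11 p) * V11 p +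
              ((ph L p.1 * V2 p - ph1 L p.1 * S p) * A211 p +
                (2 * (ph1 L p.1 * V2 p) + ph L p.1 * V21 p - ph2 L p.1 * S p) * V21 p)) -
            (P p * (ph1 L p.1 * V1 p + ph L p.1 * V11 p) + P1 p * (ph L p.1 * V1 p)) +
          (μ * (ph L p.1 * V1 p * A122 p + ph L p.1 * V12 p * V12 p +
                ((ph L p.1 * V2 p - ph1 L p.1 * S p) * A222 p +
                  (ph L p.1 * V22 p - ph1 L p.1 * V1 p) * V22 p)) -
            (P p * (ph L p.1 * V22 p - ph1 L p.1 * V1 p) +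
              P2 p * (ph L p.1 * V2 p - ph1 L p.1 * S p)))
        = μ * ((ph1 L p.1 * V1 p + ph L p.1 * V11 p) * V11 p + ph L p.1 * V12 p * V12 p
          + (2 * (ph1 L p.1 * V2 p) + ph L p.1 * V21 p - ph2 L p.1 * S p) * V21 p
          + (ph L p.1 * V22 p - ph1 L p.1 * V1 p) * V22 p)
          + ph L p.1 * V1 p * a1 p + (ph L p.1 * V2 p - ph1 L p.1 * S p) * (a2 p - g * Q p) by
      rw [e1, e2, hV]; ring]
    nlinarith [hh]
  refine main.trans ?_
  rw [integral_add (Bx_int L (by fun_prop)) (Bx_int L (by fun_prop)),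
    integral_add (Bx_int L (by fun_prop)) (Bx_int L (by fun_prop)),
    integral_const_mul, integral_const_mul,
    integral_add (f := fun p => V1 p ^ 2 + V2 p ^ 2 + a2 p ^ 2 + Q p ^ 2)
      (Bx_int L (by fun_prop)) (Bx_int L (by fun_prop))]
  have split : ∫ p in Bx L, (2 * V1 p ^ 2 + V2 p ^ 2 + a2 p ^ 2 + Q p ^ 2)
      = (∫ p in Bx L, (V1 p ^ 2 + V2 p ^ 2 + a2 p ^ 2 + Q p ^ 2)) + ∫ p in Bx L, V1 p ^ 2 := by
    rw [← integral_add (Bx_int L (by fun_prop)) (Bx_int L (by fun_prop))]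
    congr 1
    ext p
    ring
  rw [split]
  have := mul_le_mul_of_nonneg_left hS2 hC0
  linarith

lemma gron {f f' : ℝ → ℝ} {K ε a b : ℝ} (hK : 0 < K) (hd : ∀ x, HasDerivAt f (f' x) x)
    (ha : f a = 0) (bound : ∀ x ∈ Ico a b, f' x ≤ K * f x + ε) :
    ∀ x ∈ Icc a b, f x ≤ ε / K * (Real.exp (K * (x - a)) - 1) := by
  intro x hx
  have := le_gronwallBound_of_liminf_deriv_right_le (f := f) (f' := f') (δ := 0) (K := K) (ε := ε)
    (a := a) (b := b) (fun x _ => (hd x).continuousAt.continuousWithinAt)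
    (fun x _ r hr => (hd x).hasDerivWithinAt.liminf_right_slope_le hr) ha.le bound x hx
  rw [gronwallBound_of_K_ne_0 hK.ne'] at this
  simpa using this

lemma sq_dt {f F : ℝ → ℝ} {t : ℝ} (h : HasDerivAt F (f t) t) :
    HasDerivAt (fun s => F s ^ 2) (2 * (F t * f t)) t := by
  have := h.pow 2
  convert! this using 1
  push_cast
  ring

lemma zero_of_int {f : ℝ × ℝ → ℝ} (hf : Continuous f) (h0 : ∀ p, 0 ≤ f p)
    (C : ℝ) (h : ∀ L, 1 ≤ L → ∫ p in Bx L, ph L p.1 * f p ≤ C / L) :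
    ∀ p ∈ Strip, f p = 0 := by
  have key : ∀ R, 1 ≤ R → ∫ p in Bx R, f p = 0 := by
    intro R hR
    refine le_antisymm ?_ (setIntegral_nonneg (Bx_meas R) fun p _ => h0 p)
    have h1 : ∀ L, 2 * R ≤ L → (3 / 4) ^ 4 * ∫ p in Bx R, f p ≤ C / L := by
      intro L hL
      have cph := ph_cont L
      refine le_trans ?_ (h L (by linarith))
      rw [← integral_const_mul]
      have hsub : Bx R ⊆ Bx L := prod_mono (Icc_subset_Icc (by linarith) (by linarith)) subset_rfl
      calc ∫ p in Bx R, (3 / 4) ^ 4 * f p ≤ ∫ p in Bx R, ph L p.1 * f p := by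
            refine setIntegral_mono_on (Bx_int R (by fun_prop)) (Bx_int R (by fun_prop))
              (Bx_meas R) ?_
            intro p hp
            refine mul_le_mul_of_nonneg_right ?_ (h0 p)
            unfold ph
            refine pow_le_pow_left₀ (by norm_num) ?_ 4
            have hz : |p.1 / L| ≤ 1 / 2 := by
              rw [abs_div, abs_of_pos (show 0 < L by linarith), div_le_iff₀ (by linarith)]
              have := abs_le.2 hp.1
              linarith
            have := pow_le_pow_left₀ (abs_nonneg _) hz 2
            rw [sq_abs] at this
            norm_num at this ⊢
            linarith
        _ ≤ _ := by
            refine setIntegral_mono_set (Bx_int L (by fun_prop)) ?_ hsub.eventuallyLE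
            filter_upwards with p
            refine mul_nonneg ?_ (h0 p)
            unfold ph
            have : (1 - (p.1 / L) ^ 2) ^ 4 = ((1 - (p.1 / L) ^ 2) ^ 2) ^ 2 := by ring
            rw [this]; positivity
    have h2 : Tendsto (fun L : ℝ => C / L) atTop (𝓝 0) := tendsto_const_nhds.div_atTop tendsto_id
    have h3 : (3 / 4) ^ 4 * ∫ p in Bx R, f p ≤ 0 :=
      ge_of_tendsto h2 ((eventually_ge_atTop (2 * R)).mono h1)
    nlinarith
  intro p hp
  set R := max 1 |p.1| with hR
  have hpR : p ∈ Bx R := ⟨abs_le.1 (le_max_right _ _), hp.2⟩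
  have h1 := key R (le_max_left _ _)
  have hR1 : (1:ℝ) ≤ R := le_max_left _ _
  rw [setIntegral_eq_zero_iff_of_nonneg_ae (by filter_upwards with p using h0 p)
    (Bx_int R hf)] at h1
  have := Measure.eqOn_of_ae_eq (μ := volume) (s := Bx R) h1 hf.continuousOn continuousOn_const
    (by
      unfold Bx
      rw [interior_prod_eq, interior_Icc, interior_Icc, closure_prod_eq,
        closure_Ioo (by linarith), closure_Ioo (by norm_num)])
  exact this hpR

lemma time_zero {g t0 t1 M B C : ℝ} (hg : 0 < g) (hM : 0 ≤ M) (hC : 0 ≤ C)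
    {v1 v2 Θ : ℝ × ℝ × ℝ → ℝ} {D : ℝ → ℝ}
    (c1 : Continuous v1) (c2 : Continuous v2) (cΘ : Continuous Θ)
    (hD : ∀ y ∈ Icc (0 : ℝ) 1, |D y| ≤ M)
    (hΘ : ∀ t ∈ Icc t0 t1, ∀ x ∈ Strip, Θ (t, x) = - (D x.2 * TI t0 v2 (t, x)))
    (hbd : ∀ t ∈ Icc t0 t1, ∀ L, 1 ≤ L →
      ∫ x in Bx L, (v1 (t, x) ^ 2 + v2 (t, x) ^ 2 + Θ (t, x) ^ 2) ≤ B)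
    (hen : ∀ t ∈ Icc t0 t1, ∀ B, (∀ L, 1 ≤ L → ∫ x in Bx L, TI t0 v1 (t, x) ^ 2 ≤ B) →
      ∀ L, 1 ≤ L →
      ∫ x in Bx L, ph L x.1 * (TI t0 v1 (t, x) * v1 (t, x) + TI t0 v2 (t, x) * v2 (t, x)) ≤
      g * (∫ x in Bx L, ph L x.1 * (TI t0 Θ (t, x) * TI t0 v2 (t, x))) +
      C / L * ∫ x in Bx L, (2 * TI t0 v1 (t, x) ^ 2 + TI t0 v2 (t, x) ^ 2 + v2 (t, x) ^ 2
        + TI t0 Θ (t, x) ^ 2)) :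
    ∀ t ∈ Icc t0 t1, ∀ x ∈ Strip, TI t0 v1 (t, x) = 0 ∧ TI t0 v2 (t, x) = 0 := by
  have d1 := TI_dt t0 c1
  have d2 := TI_dt t0 c2
  have d3 := TI_dt t0 cΘ
  have C1 := TI_cont t0 c1
  have C2 := TI_cont t0 c2
  have C3 := TI_cont t0 cΘ
  have z : ∀ (f : ℝ × ℝ × ℝ → ℝ) x, TI t0 f (t0, x) = 0 := fun f x => by simp [TI]
  set V1 := TI t0 v1
  set V2 := TI t0 v2
  set Q := TI t0 Θ
  have zV1 : ∀ x, V1 (t0, x) = 0 := z v1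
  have zV2 : ∀ x, V2 (t0, x) = 0 := z v2
  have zQ : ∀ x, Q (t0, x) = 0 := z Θ
  have hsum : ∀ t x, HasDerivAt (fun s => V1 (s, x) ^ 2 + V2 (s, x) ^ 2 + Q (s, x) ^ 2)
      (2 * (V1 (t, x) * v1 (t, x)) + 2 * (V2 (t, x) * v2 (t, x))
        + 2 * (Q (t, x) * Θ (t, x))) t := by
    intro t x
    have a1 := sq_dt (F := fun s => V1 (s, x)) (f := fun s => v1 (s, x)) (d1 t x)
    have a2 := sq_dt (F := fun s => V2 (s, x)) (f := fun s => v2 (s, x)) (d2 t x)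
    have a3 := sq_dt (F := fun s => Q (s, x)) (f := fun s => Θ (s, x)) (d3 t x)
    exact (a1.fun_add a2).fun_add a3
  -- unweighted bound
  have hdN : ∀ L t, HasDerivAt (fun t => ∫ x in Bx L, (V1 (t, x) ^ 2 + V2 (t, x) ^ 2 + Q (t, x) ^ 2))
      (∫ x in Bx L, (2 * (V1 (t, x) * v1 (t, x)) + 2 * (V2 (t, x) * v2 (t, x))
        + 2 * (Q (t, x) * Θ (t, x)))) t := by
    intro L t
    exact hasDerivAt_setIntegral_compact (Bx_compact L)
      (F := fun t x => V1 (t, x) ^ 2 + V2 (t, x) ^ 2 + Q (t, x) ^ 2)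
      (F' := fun t x => 2 * (V1 (t, x) * v1 (t, x)) + 2 * (V2 (t, x) * v2 (t, x))
        + 2 * (Q (t, x) * Θ (t, x))) (by fun_prop) (by fun_prop)
      hsum t
  have hdG : ∀ L t, HasDerivAt
      (fun t => ∫ x in Bx L, ph L x.1 * (V1 (t, x) ^ 2 + V2 (t, x) ^ 2 + Q (t, x) ^ 2))
      (∫ x in Bx L, ph L x.1 * (2 * (V1 (t, x) * v1 (t, x)) + 2 * (V2 (t, x) * v2 (t, x))
        + 2 * (Q (t, x) * Θ (t, x)))) t := by
    intro L t
    have cph := ph_cont L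
    exact hasDerivAt_setIntegral_compact (Bx_compact L)
      (F := fun t x => ph L x.1 * (V1 (t, x) ^ 2 + V2 (t, x) ^ 2 + Q (t, x) ^ 2))
      (F' := fun t x => ph L x.1 * (2 * (V1 (t, x) * v1 (t, x)) + 2 * (V2 (t, x) * v2 (t, x))
        + 2 * (Q (t, x) * Θ (t, x)))) (by fun_prop) (by fun_prop)
      (fun t x => (hsum t x).const_mul (ph L x.1)) t
  intro t ht
  have hB0 : 0 ≤ B := le_trans (setIntegral_nonneg (Bx_meas 1) fun x _ => by positivity)
    (hbd t ht 1 le_rfl)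
  set B' := B / 1 * (Real.exp (1 * (t1 - t0)) - 1) with hB'
  have hN : ∀ L, 1 ≤ L → ∀ t ∈ Icc t0 t1,
      ∫ x in Bx L, (V1 (t, x) ^ 2 + V2 (t, x) ^ 2 + Q (t, x) ^ 2) ≤ B' := by
    intro L hL t ht
    have := gron (K := 1) (ε := B) (a := t0) (b := t1) one_pos (hdN L) (by simp [zV1, zV2, zQ]) ?_ t ht
    · refine this.trans ?_
      rw [hB']
      gcongr
      exact ht.2
    · intro s hs
      have := hbd s ⟨hs.1, hs.2.le⟩ L hL
      refine le_trans ?_ (add_le_add_right this _)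
      rw [one_mul, ← integral_add (Bx_int L (by fun_prop)) (Bx_int L (by fun_prop))]
      refine setIntegral_mono_on (Bx_int L (by fun_prop)) (Bx_int L (by fun_prop))
              (Bx_meas L) ?_
      intro x _
      nlinarith [sq_nonneg (V1 (s, x) - v1 (s, x)), sq_nonneg (V2 (s, x) - v2 (s, x)),
        sq_nonneg (Q (s, x) - Θ (s, x))]
  have hB'0 : 0 ≤ B' := le_trans (setIntegral_nonneg (Bx_meas 1) fun x _ => by positivity)
    (hN 1 le_rfl t ht)
  have hV1 : ∀ t ∈ Icc t0 t1, ∀ L, 1 ≤ L → ∫ x in Bx L, V1 (t, x) ^ 2 ≤ B' := by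
    intro t ht L hL
    refine le_trans ?_ (hN L hL t ht)
    refine setIntegral_mono_on (Bx_int L (by fun_prop)) (Bx_int L (by fun_prop)) (Bx_meas L) ?_
    intro x _
    nlinarith [sq_nonneg (V2 (t, x)), sq_nonneg (Q (t, x))]
  set K := g + M with hKdef
  have hK : 0 < K := by positivity
  have hG : ∀ L, 1 ≤ L → ∫ x in Bx L, ph L x.1 * (V1 (t, x) ^ 2 + V2 (t, x) ^ 2 + Q (t, x) ^ 2)
      ≤ (2 * C * (2 * B' + B) / K * (Real.exp (K * (t - t0)) - 1)) / L := by
    intro L hL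
    have cph := ph_cont L
    have hL0 : 0 < L := by linarith
    have := gron (K := K) (ε := 2 * (C / L * (2 * B' + B))) (a := t0) (b := t1) hK (hdG L)
      (by simp [zV1, zV2, zQ]) ?_ t ht
    · refine this.trans (le_of_eq ?_)
      ring
    · intro s hs'
      have hs : s ∈ Icc t0 t1 := ⟨hs'.1, hs'.2.le⟩
      have e1 := hen s hs B' (hV1 s hs) L hL
      have e2 : ∫ x in Bx L, (2 * V1 (s, x) ^ 2 + V2 (s, x) ^ 2 + v2 (s, x) ^ 2
        + Q (s, x) ^ 2) ≤ 2 * B' + B := by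
        have a1 := hN L hL s hs
        have a2 := hbd s hs L hL
        have : 2 * B' + B ≥ 2 * (∫ x in Bx L, (V1 (s, x) ^ 2 + V2 (s, x) ^ 2 + Q (s, x) ^ 2))
            + ∫ x in Bx L, (v1 (s, x) ^ 2 + v2 (s, x) ^ 2 + Θ (s, x) ^ 2) := by linarith
        refine le_trans ?_ this
        rw [← integral_const_mul,
          ← integral_add (Bx_int L (by fun_prop)) (Bx_int L (by fun_prop))]
        refine setIntegral_mono_on (Bx_int L (by fun_prop)) (Bx_int L (by fun_prop))
              (Bx_meas L) ?_
        intro x _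
        nlinarith [sq_nonneg (V2 (s, x)), sq_nonneg (Q (s, x)), sq_nonneg (v1 (s, x)),
          sq_nonneg (Θ (s, x))]
      have e3 : C / L * (∫ x in Bx L, (2 * V1 (s, x) ^ 2 + V2 (s, x) ^ 2 + v2 (s, x) ^ 2
        + Q (s, x) ^ 2)) ≤ C / L * (2 * B' + B) := by gcongr
      have e4 : ∫ x in Bx L, ph L x.1 * (2 * (V1 (s, x) * v1 (s, x)) + 2 * (V2 (s, x) * v2 (s, x))
        + 2 * (Q (s, x) * Θ (s, x))) =
        2 * (∫ x in Bx L, ph L x.1 * (V1 (s, x) * v1 (s, x) + V2 (s, x) * v2 (s, x)))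
        + ∫ x in Bx L, 2 * (ph L x.1 * (Q (s, x) * Θ (s, x))) := by
        rw [← integral_const_mul,
          ← integral_add (Bx_int L (by fun_prop)) (Bx_int L (by fun_prop))]
        congr 1; ext x; ring
      have e5 : 2 * (g * (∫ x in Bx L, ph L x.1 * (Q (s, x) * V2 (s, x))))
          + ∫ x in Bx L, 2 * (ph L x.1 * (Q (s, x) * Θ (s, x)))
          ≤ K * ∫ x in Bx L, ph L x.1 * (V1 (s, x) ^ 2 + V2 (s, x) ^ 2 + Q (s, x) ^ 2) := by
        rw [← integral_const_mul, ← integral_const_mul, ← integral_const_mul,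
          ← integral_add (Bx_int L (by fun_prop)) (Bx_int L (by fun_prop))]
        refine setIntegral_mono_on (Bx_int L (by fun_prop)) (Bx_int L (by fun_prop))
              (Bx_meas L) ?_
        intro x hx
        obtain ⟨χ, e, f, -, -, q1, -⟩ := ph_bounds hL hx.1
        have hph : 0 ≤ ph L x.1 := by
          rw [q1, show χ ^ 4 = (χ ^ 2) ^ 2 by ring]; positivity
        rw [hΘ s hs x (Bx_sub L hx)]
        have hDx := abs_le.1 (hD x.2 hx.2)
        generalize ph L x.1 = φ at hph
        generalize D x.2 = d at hDx
        generalize Q (s, x) = q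
        generalize V2 (s, x) = w
        generalize V1 (s, x) = u
        have k1 : 2 * (q * w) * (g - d) ≤ K * (u ^ 2 + w ^ 2 + q ^ 2) := by
          have n1 : 0 ≤ g - d + (g + M) + (M - g) := by linarith [hDx.2]
          have a1 : 0 ≤ K - (g - d) := by rw [hKdef]; linarith [hDx.1]
          have a2 : 0 ≤ K + (g - d) := by rw [hKdef]; linarith [hDx.2]
          nlinarith [mul_nonneg a1 (sq_nonneg (q + w)), mul_nonneg a2 (sq_nonneg (q - w)),
            mul_nonneg hK.le (sq_nonneg u)]
        have := mul_le_mul_of_nonneg_left k1 hph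
        calc _ = φ * (2 * (q * w) * (g - d)) := by ring
          _ ≤ _ := this
          _ = _ := by ring
      rw [e4]
      linarith
  have := zero_of_int (f := fun x => V1 (t, x) ^ 2 + V2 (t, x) ^ 2 + Q (t, x) ^ 2)
    (by fun_prop) (fun p => by positivity) _ hG
  intro x hx
  have h := this x hx
  have q1 := sq_nonneg (V1 (t, x))
  have q2 := sq_nonneg (V2 (t, x))
  have q3 := sq_nonneg (Q (t, x))
  exact ⟨pow_eq_zero_iff two_ne_zero |>.1 (by linarith), pow_eq_zero_iff two_ne_zero |>.1 (by linarith)⟩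

lemma sd_PD {f : ℝ × ℝ × ℝ → ℝ} (t : ℝ) (h : Differentiable ℝ (fun y : ℝ × ℝ => f (t, y)))
    (y : ℝ × ℝ) : PDat (fun y => f (t, y)) (sd1 f (t, y)) (sd2 f (t, y)) y :=
  PDat.mk' (h y).hasFDerivAt rfl rfl

lemma slice_fderiv {f : ℝ × ℝ × ℝ → ℝ} (hf : ContDiff ℝ 1 f) (p : ℝ × ℝ × ℝ) (w : ℝ × ℝ) :
    fderiv ℝ (fun y : ℝ × ℝ => f (p.1, y)) p.2 w = fderiv ℝ f p (0, w) := by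
  have h1 : HasFDerivAt f (fderiv ℝ f p) (p.1, p.2) :=
    (hf.differentiable one_ne_zero p).hasFDerivAt
  have h2 : HasFDerivAt (fun y : ℝ × ℝ => (p.1, y)) (ContinuousLinearMap.inr ℝ ℝ (ℝ × ℝ)) p.2 :=
    hasFDerivAt_prodMk_right p.1 p.2
  have := h1.comp p.2 h2
  have e := this.fderiv
  have e2 : fderiv ℝ (fun y : ℝ × ℝ => f (p.1, y)) p.2 =
    (fderiv ℝ f p).comp (ContinuousLinearMap.inr ℝ ℝ (ℝ × ℝ)) := e
  rw [e2]; simp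

lemma sd1_cont {f : ℝ × ℝ × ℝ → ℝ} (hf : ContDiff ℝ 1 f) : Continuous (sd1 f) := by
  have : sd1 f = fun p => fderiv ℝ f p (0, 1, 0) := funext fun p => slice_fderiv hf p _
  rw [this]
  exact (hf.continuous_fderiv one_ne_zero).clm_apply continuous_const

lemma sd2_cont {f : ℝ × ℝ × ℝ → ℝ} (hf : ContDiff ℝ 1 f) : Continuous (sd2 f) := by
  have : sd2 f = fun p => fderiv ℝ f p (0, 0, 1) := funext fun p => slice_fderiv hf p _
  rw [this]
  exact (hf.continuous_fderiv one_ne_zero).clm_apply continuous_const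

lemma td_dt {f : ℝ × ℝ × ℝ → ℝ} (hf : ContDiff ℝ 1 f) (t : ℝ) (x : ℝ × ℝ) :
    HasDerivAt (fun s => f (s, x)) (td f (t, x)) t := by
  have h : Differentiable ℝ (fun s => f (s, x)) :=
    (hf.differentiable one_ne_zero).comp (by fun_prop)
  exact (h t).hasDerivAt

lemma td_cont {f : ℝ × ℝ × ℝ → ℝ} (hf : ContDiff ℝ 1 f) : Continuous (td f) := by
  have : td f = fun p => fderiv ℝ f p (1, 0) := by
    funext p
    have h1 : HasFDerivAt f (fderiv ℝ f p) (p.1, p.2) :=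
      (hf.differentiable one_ne_zero p).hasFDerivAt
    have h2 : HasDerivAt (fun s : ℝ => (s, p.2)) ((1 : ℝ), (0 : ℝ × ℝ)) p.1 :=
      (hasDerivAt_id p.1).prodMk (hasDerivAt_const p.1 p.2)
    exact (h1.comp_hasDerivAt p.1 h2).deriv
  rw [this]
  exact (hf.continuous_fderiv one_ne_zero).clm_apply continuous_const

lemma sd_diff {f : ℝ × ℝ × ℝ → ℝ} (t : ℝ) (h : ContDiff ℝ 2 (fun y : ℝ × ℝ => f (t, y))) :
    Differentiable ℝ (fun y : ℝ × ℝ => sd1 f (t, y)) ∧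
    Differentiable ℝ (fun y : ℝ × ℝ => sd2 f (t, y)) := by
  have h1 : ContDiff ℝ 1 (fderiv ℝ (fun y : ℝ × ℝ => f (t, y))) :=
    h.fderiv_right (by norm_num)
  have h2 := h1.differentiable one_ne_zero
  exact ⟨h2.clm_apply (differentiable_const _), h2.clm_apply (differentiable_const _)⟩

lemma strip_closure {f : ℝ × ℝ → ℝ} (hf : Continuous f)
    (h : ∀ x : ℝ × ℝ, x.2 ∈ Ioo (0 : ℝ) 1 → f x = 0) : ∀ x ∈ Strip, f x = 0 := by
  have h1 : EqOn f (fun _ => 0) ((univ : Set ℝ) ×ˢ Ioo (0 : ℝ) 1) := fun x hx => h x hx.2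
  have h2 := h1.closure hf continuous_const
  rw [closure_prod_eq, closure_univ, closure_Ioo (by norm_num)] at h2
  exact h2

lemma fd_zero {f : ℝ × ℝ → ℝ} (h : ∀ x ∈ Strip, f x = 0) (x : ℝ × ℝ)
    (hx : x.2 ∈ Ioo (0 : ℝ) 1) : fderiv ℝ f x = 0 := by
  have : f =ᶠ[𝓝 x] fun _ => 0 := by
    have ho : IsOpen {y : ℝ × ℝ | y.2 ∈ Ioo (0 : ℝ) 1} := isOpen_Ioo.preimage continuous_snd
    filter_upwards [ho.mem_nhds hx] with y hy
    exact h y ⟨mem_univ _, hy.1.le, hy.2.le⟩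
  rw [this.fderiv_eq]; simp

lemma sd1_zero {f : ℝ × ℝ × ℝ → ℝ} {t : ℝ} (hc : Continuous (sd1 f))
    (h : ∀ x ∈ Strip, f (t, x) = 0) : ∀ x ∈ Strip, sd1 f (t, x) = 0 := by
  refine strip_closure (f := fun x => sd1 f (t, x)) (by fun_prop) fun x hx => ?_
  simp only [sd1]
  rw [fd_zero h x hx]; rfl

lemma sd2_zero {f : ℝ × ℝ × ℝ → ℝ} {t : ℝ} (hc : Continuous (sd2 f))
    (h : ∀ x ∈ Strip, f (t, x) = 0) : ∀ x ∈ Strip, sd2 f (t, x) = 0 := by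
  refine strip_closure (f := fun x => sd2 f (t, x)) (by fun_prop) fun x hx => ?_
  simp only [sd2]
  rw [fd_zero h x hx]; rfl

lemma strip_meas : MeasurableSet Strip := MeasurableSet.univ.prod measurableSet_Icc

lemma l2b {T t0 : ℝ} {f : ℝ × ℝ × ℝ → ℝ} (hf : ContDiff ℝ 1 f) (h : C1IntoL2 T f)
    (hs : SqIntOn T f) (ht0 : t0 ∈ Ico 0 T) (hz : ∀ x ∈ Strip, f (t0, x) = 0)
    (htd : IntegrableOn (fun x => td f (t0, x) ^ 2) Strip) :
    ∃ δ > 0, ∃ B, ∀ t ∈ Icc t0 (t0 + δ), t ≤ T → ∀ L, ∫ x in Bx L, f (t, x) ^ 2 ≤ B := by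
  have cf := hf.continuous
  have ctd := td_cont hf
  have h1 := h.1 t0 ⟨ht0.1, ht0.2.le⟩
  have h2 := h1.eventually (gt_mem_nhds (zero_lt_one' ℝ))
  rw [eventually_nhdsWithin_iff, Metric.eventually_nhds_iff] at h2
  obtain ⟨δ, hδ, h2⟩ := h2
  refine ⟨min (δ / 2) 1, by positivity, 2 + 2 * ∫ x in Strip, td f (t0, x) ^ 2, ?_⟩
  intro t ht htT L
  have hI0 : 0 ≤ ∫ x in Strip, td f (t0, x) ^ 2 :=
    integral_nonneg fun x => by positivity
  have hsub := Bx_sub L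
  rcases eq_or_lt_of_le ht.1 with rfl | hlt
  · rw [setIntegral_congr_fun (g := fun _ => (0 : ℝ)) (Bx_meas L)
      (fun x hx => by simp [hz x (hsub hx)])]
    simp; linarith
  set k := t - t0 with hk
  have hk0 : 0 < k := by linarith
  have hkδ : k ≤ δ / 2 := by have := ht.2.trans (add_le_add_right (min_le_left _ _) t0); linarith
  have hk1 : k ≤ 1 := by have := ht.2.trans (add_le_add_right (min_le_right _ _) t0); linarith
  have htk : t0 + k = t := by linarith
  have h3 := h2 (y := k) (by rw [Real.dist_eq, sub_zero, abs_of_pos hk0]; linarith)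
    ⟨by rw [htk]; exact ⟨ht0.1.trans ht.1, htT⟩, hk0.ne'⟩
  rw [htk] at h3
  have hst := hs t ⟨ht0.1.trans ht.1, htT⟩
  have hint : IntegrableOn (fun x => ((f (t, x) - f (t0, x)) / k - td f (t0, x)) ^ 2) Strip := by
    refine Integrable.mono' ((hst.const_mul (2 / k ^ 2)).add (htd.const_mul 2)) ?_ ?_
    · refine Continuous.aestronglyMeasurable ?_
      fun_prop
    · refine ae_restrict_of_forall_mem strip_meas fun x hx => ?_
      rw [Real.norm_of_nonneg (sq_nonneg _), hz x hx, sub_zero]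
      simp only [Pi.add_apply]
      have : 2 / k ^ 2 * f (t, x) ^ 2 = 2 * (f (t, x) / k) ^ 2 := by field_simp
      rw [this]
      nlinarith [sq_nonneg (f (t, x) / k + td f (t0, x))]
  calc ∫ x in Bx L, f (t, x) ^ 2 ≤ ∫ x in Strip, f (t, x) ^ 2 :=
        setIntegral_mono_set hst (by filter_upwards with x using sq_nonneg _) hsub.eventuallyLE
    _ ≤ ∫ x in Strip, (2 * ((f (t, x) - f (t0, x)) / k - td f (t0, x)) ^ 2
          + 2 * td f (t0, x) ^ 2) := by
        refine setIntegral_mono_on hst ((hint.const_mul 2).add (htd.const_mul 2)) strip_meas ?_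
        intro x hx
        rw [hz x hx, sub_zero]
        have e : f (t, x) ^ 2 = k ^ 2 * (f (t, x) / k) ^ 2 := by field_simp
        have e2 : k ^ 2 * (f (t, x) / k) ^ 2 ≤ 1 * (f (t, x) / k) ^ 2 := by
          gcongr
          nlinarith
        nlinarith [sq_nonneg (f (t, x) / k - td f (t0, x) - td f (t0, x))]
    _ = 2 * (∫ x in Strip, ((f (t, x) - f (t0, x)) / k - td f (t0, x)) ^ 2)
          + 2 * ∫ x in Strip, td f (t0, x) ^ 2 := by
        rw [integral_add (hint.const_mul 2) (htd.const_mul 2), integral_const_mul,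
          integral_const_mul]
    _ ≤ _ := by linarith

lemma TI_congr {t0 t : ℝ} {f g : ℝ × ℝ × ℝ → ℝ} {x y : ℝ × ℝ} (ht : t0 ≤ t)
    (h : ∀ s ∈ Icc t0 t, f (s, x) = g (s, y)) : TI t0 f (t, x) = TI t0 g (t, y) := by
  unfold TI
  refine intervalIntegral.integral_congr fun s hs => ?_
  rw [uIcc_of_le ht] at hs
  exact h s hs

lemma TI_add (t0 : ℝ) {f g : ℝ × ℝ × ℝ → ℝ} (hf : Continuous f) (hg : Continuous g)
    (p : ℝ × ℝ × ℝ) : TI t0 (fun p => f p + g p) p = TI t0 f p + TI t0 g p := by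
  unfold TI
  exact intervalIntegral.integral_add (Continuous.intervalIntegrable (by fun_prop) _ _)
    (Continuous.intervalIntegrable (by fun_prop) _ _)

lemma TI_sub (t0 : ℝ) {f g : ℝ × ℝ × ℝ → ℝ} (hf : Continuous f) (hg : Continuous g)
    (p : ℝ × ℝ × ℝ) : TI t0 (fun p => f p - g p) p = TI t0 f p - TI t0 g p := by
  unfold TI
  exact intervalIntegral.integral_sub (Continuous.intervalIntegrable (by fun_prop) _ _)
    (Continuous.intervalIntegrable (by fun_prop) _ _)

lemma TI_cmul (t0 c : ℝ) (f : ℝ × ℝ × ℝ → ℝ)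
    (p : ℝ × ℝ × ℝ) : TI t0 (fun p => c * f p) p = c * TI t0 f p := by
  unfold TI
  exact intervalIntegral.integral_const_mul _ _

lemma TI_zero (t0 : ℝ) (p : ℝ × ℝ × ℝ) : TI t0 (fun _ => 0) p = 0 := by
  unfold TI; simp

lemma TI_td {f : ℝ × ℝ × ℝ → ℝ} (hf : ContDiff ℝ 1 f) {t0 : ℝ} {x : ℝ × ℝ}
    (h0 : f (t0, x) = 0) (t : ℝ) : TI t0 (td f) (t, x) = f (t, x) := by
  have ctd := td_cont hf
  unfold TI
  have := intervalIntegral.integral_eq_sub_of_hasDerivAt (a := t0) (b := t)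
    (f := fun s => f (s, x)) (f' := fun s => td f (s, x)) (fun s _ => td_dt hf s x)
    (Continuous.intervalIntegrable (by fun_prop) _ _)
  simp only [this, h0, sub_zero]


/-- Uniqueness for the linearized perturbed problem on the strip. -/
theorem linearized_uniqueness (μ g k0 k1 T : ℝ)
    (hμ : 0 < μ) (hg : 0 < g) (hk0 : k0 ≤ 0) (hk1 : k1 ≤ 0) (hT : 0 < T)
    (θb : ℝ → ℝ) (hθb : ContDiff ℝ (⊤ : ℕ∞) θb)
    (v1 v2 pr Θ : ℝ × ℝ × ℝ → ℝ)
    -- regularity: v continuous with continuous first time derivative and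
    -- first and second spatial derivatives; π and Θ continuously differentiable
    (hv1 : ContDiff ℝ 1 v1) (hv2 : ContDiff ℝ 1 v2)
    (hv1x : ∀ t : ℝ, ContDiff ℝ 2 (fun y : ℝ × ℝ => v1 (t, y)))
    (hv2x : ∀ t : ℝ, ContDiff ℝ 2 (fun y : ℝ × ℝ => v2 (t, y)))
    (hv1xx : Continuous (sd1 (sd1 v1)) ∧ Continuous (sd1 (sd2 v1)) ∧
      Continuous (sd2 (sd1 v1)) ∧ Continuous (sd2 (sd2 v1)))
    (hv2xx : Continuous (sd1 (sd1 v2)) ∧ Continuous (sd1 (sd2 v2)) ∧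
      Continuous (sd2 (sd1 v2)) ∧ Continuous (sd2 (sd2 v2)))
    (hpr : ContDiff ℝ 1 pr) (hΘ : ContDiff ℝ 1 Θ)
    -- linearized momentum equations, with gravity vector (0, g)
    (hmom1 : ∀ p ∈ (Icc (0 : ℝ) T) ×ˢ Strip,
      td v1 p + sd1 pr p = μ * (sd1 (sd1 v1) p + sd2 (sd2 v1) p) + Θ p * 0)
    (hmom2 : ∀ p ∈ (Icc (0 : ℝ) T) ×ˢ Strip,
      td v2 p + sd2 pr p = μ * (sd1 (sd1 v2) p + sd2 (sd2 v2) p) + Θ p * g)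
    -- linearized transport equation
    (htrans : ∀ p ∈ (Icc (0 : ℝ) T) ×ˢ Strip,
      td Θ p + v2 p * deriv θb p.2.2 = 0)
    -- incompressibility
    (hdiv : ∀ p ∈ (Icc (0 : ℝ) T) ×ˢ Strip, sd1 v1 p + sd2 v2 p = 0)
    -- Navier boundary conditions
    (hbc : ∀ t ∈ Icc (0 : ℝ) T, ∀ x₁ : ℝ,
      v2 (t, x₁, 0) = 0 ∧ v2 (t, x₁, 1) = 0 ∧
      sd2 v1 (t, x₁, 1) = (k1 / μ) * v1 (t, x₁, 1) ∧
      sd2 v1 (t, x₁, 0) = -(k0 / μ) * v1 (t, x₁, 0))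
    -- square integrability of v, ∇v, Θ, π and ∇π at each time
    (hint : SqIntOn T v1 ∧ SqIntOn T v2 ∧
      SqIntOn T (sd1 v1) ∧ SqIntOn T (sd2 v1) ∧
      SqIntOn T (sd1 v2) ∧ SqIntOn T (sd2 v2) ∧
      SqIntOn T Θ ∧ SqIntOn T pr ∧ SqIntOn T (sd1 pr) ∧ SqIntOn T (sd2 pr))
    -- t ↦ v(t,·) and t ↦ Θ(t,·) are C¹ into L²
    (hC1 : C1IntoL2 T v1 ∧ C1IntoL2 T v2 ∧ C1IntoL2 T Θ)
    -- zero initial data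
    (hinit : ∀ x ∈ Strip, v1 (0, x) = 0 ∧ v2 (0, x) = 0 ∧ Θ (0, x) = 0) :
    ∀ p ∈ (Icc (0 : ℝ) T) ×ˢ Strip, v1 p = 0 ∧ v2 p = 0 ∧ Θ p = 0 := by
  obtain ⟨i1, i2, i11, i12, i21, i22, iΘ, ipr, ip1, ip2⟩ := hint
  obtain ⟨C1, C2, C3⟩ := hC1
  obtain ⟨cx111, cx121, cx112, cx122⟩ := hv1xx
  obtain ⟨cx211, cx221, cx212, cx222⟩ := hv2xx
  have c1 := hv1.continuous
  have c2 := hv2.continuous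
  have cΘ := hΘ.continuous
  have cp := hpr.continuous
  have c11 := sd1_cont hv1
  have c12 := sd2_cont hv1
  have c21 := sd1_cont hv2
  have c22 := sd2_cont hv2
  have cp1 := sd1_cont hpr
  have cp2 := sd2_cont hpr
  have cD : Continuous (deriv θb) := hθb.continuous_deriv (by simp)
  obtain ⟨M0, hM0⟩ := (isCompact_Icc (a := (0 : ℝ)) (b := 1)).exists_bound_of_continuousOn
    cD.continuousOn
  have hM : ∀ y ∈ Icc (0 : ℝ) 1, |deriv θb y| ≤ |M0| := fun y hy =>
    (hM0 y hy).trans (le_abs_self _)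
  have P1 : ∀ t y, PDat (fun y => v1 (t, y)) (sd1 v1 (t, y)) (sd2 v1 (t, y)) y := fun t =>
    sd_PD t ((hv1x t).differentiable two_ne_zero)
  have P2 : ∀ t y, PDat (fun y => v2 (t, y)) (sd1 v2 (t, y)) (sd2 v2 (t, y)) y := fun t =>
    sd_PD t ((hv2x t).differentiable two_ne_zero)
  have P11 : ∀ t y, PDat (fun y => sd1 v1 (t, y)) (sd1 (sd1 v1) (t, y)) (sd2 (sd1 v1) (t, y)) y :=
    fun t => sd_PD t (sd_diff t (hv1x t)).1
  have P12 : ∀ t y, PDat (fun y => sd2 v1 (t, y)) (sd1 (sd2 v1) (t, y)) (sd2 (sd2 v1) (t, y)) y :=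
    fun t => sd_PD t (sd_diff t (hv1x t)).2
  have P21 : ∀ t y, PDat (fun y => sd1 v2 (t, y)) (sd1 (sd1 v2) (t, y)) (sd2 (sd1 v2) (t, y)) y :=
    fun t => sd_PD t (sd_diff t (hv2x t)).1
  have P22 : ∀ t y, PDat (fun y => sd2 v2 (t, y)) (sd1 (sd2 v2) (t, y)) (sd2 (sd2 v2) (t, y)) y :=
    fun t => sd_PD t (sd_diff t (hv2x t)).2
  have Pp : ∀ t y, PDat (fun y => pr (t, y)) (sd1 pr (t, y)) (sd2 pr (t, y)) y := fun t =>
    sd_PD t ((hpr.differentiable one_ne_zero).comp (by fun_prop))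
  set s : Set ℝ := {t | ∀ x ∈ Strip, v1 (t, x) = 0 ∧ v2 (t, x) = 0 ∧ Θ (t, x) = 0} with hs
  have hclosed : IsClosed s := by
    have : s = ⋂ x ∈ Strip, ({t | v1 (t, x) = 0} ∩ ({t | v2 (t, x) = 0} ∩ {t | Θ (t, x) = 0})) := by
      ext t; simp [hs]
    rw [this]
    refine isClosed_biInter fun x _ => ?_
    exact (isClosed_eq (by fun_prop) continuous_const).inter
      ((isClosed_eq (by fun_prop) continuous_const).inter
        (isClosed_eq (by fun_prop) continuous_const))
  have hmain : Icc 0 T ⊆ s := by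
    refine IsClosed.Icc_subset_of_forall_mem_nhdsWithin (hclosed.inter isClosed_Icc) hinit ?_
    rintro t0 ⟨hts, ht0⟩
    have z1 : ∀ x ∈ Strip, v1 (t0, x) = 0 := fun x hx => (hts x hx).1
    have z2 : ∀ x ∈ Strip, v2 (t0, x) = 0 := fun x hx => (hts x hx).2.1
    have z3 : ∀ x ∈ Strip, Θ (t0, x) = 0 := fun x hx => (hts x hx).2.2
    have ht0' : t0 ∈ Icc 0 T := ⟨ht0.1, ht0.2.le⟩
    have y11 := sd1_zero cx111 (sd1_zero c11 z1)
    have y12 := sd2_zero cx122 (sd2_zero c12 z1)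
    have y21 := sd1_zero cx211 (sd1_zero c21 z2)
    have y22 := sd2_zero cx222 (sd2_zero c22 z2)
    have I1 : IntegrableOn (fun x => td v1 (t0, x) ^ 2) Strip := by
      refine (ip1 t0 ht0').congr_fun (fun x hx => ?_) strip_meas
      have := hmom1 (t0, x) ⟨ht0', hx⟩
      rw [y11 x hx, y12 x hx] at this
      have e : td v1 (t0, x) = - sd1 pr (t0, x) := by linarith
      simp only [e, neg_sq]
    have I2 : IntegrableOn (fun x => td v2 (t0, x) ^ 2) Strip := by
      refine (ip2 t0 ht0').congr_fun (fun x hx => ?_) strip_meas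
      have := hmom2 (t0, x) ⟨ht0', hx⟩
      rw [y21 x hx, y22 x hx, z3 x hx] at this
      have e : td v2 (t0, x) = - sd2 pr (t0, x) := by linarith
      simp only [e, neg_sq]
    have I3 : IntegrableOn (fun x => td Θ (t0, x) ^ 2) Strip := by
      refine (integrableOn_zero : IntegrableOn (fun _ : ℝ × ℝ => (0 : ℝ)) Strip).congr_fun (fun x hx => ?_) strip_meas
      have := htrans (t0, x) ⟨ht0', hx⟩
      rw [z2 x hx] at this
      have e : td Θ (t0, x) = 0 := by linarith
      simp [e]
    obtain ⟨δ1, hδ1, B1, hB1⟩ := l2b hv1 C1 i1 ht0 z1 I1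
    obtain ⟨δ2, hδ2, B2, hB2⟩ := l2b hv2 C2 i2 ht0 z2 I2
    obtain ⟨δ3, hδ3, B3, hB3⟩ := l2b hΘ C3 iΘ ht0 z3 I3
    obtain ⟨t1, ht01, k1', k2', k3', k4'⟩ : ∃ t1, t0 < t1 ∧ t1 ≤ T ∧ t1 ≤ t0 + δ1 ∧ t1 ≤ t0 + δ2 ∧
        t1 ≤ t0 + δ3 := by
      refine ⟨min T (min (t0 + δ1) (min (t0 + δ2) (t0 + δ3))), ?_, ?_, ?_, ?_, ?_⟩
      · have := ht0.2
        simp only [lt_min_iff]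
        refine ⟨this, ?_, ?_, ?_⟩ <;> linarith
      all_goals simp
    have hI : ∀ t ∈ Icc t0 t1, ∀ r ∈ Icc t0 t, r ∈ Icc 0 T := fun t ht r hr =>
      ⟨ht0.1.trans hr.1, hr.2.trans (ht.2.trans k1')⟩
    have hTΘ : ∀ t ∈ Icc t0 t1, ∀ x ∈ Strip, Θ (t, x) = - (deriv θb x.2 * TI t0 v2 (t, x)) := by
      intro t ht x hx
      rw [← TI_td hΘ (z3 x hx) t, ← neg_mul, ← TI_cmul]
      refine TI_congr ht.1 fun r hr => ?_
      have := htrans (r, x) ⟨hI t ht r hr, hx⟩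
      simp only at this
      linarith
    have hz := time_zero (t0 := t0) (t1 := t1) (M := |M0|) (B := B1 + B2 + B3)
      (C := 1568 * μ + 8 + 8 * g) (v1 := v1) (v2 := v2) (Θ := Θ) (D := deriv θb) hg (abs_nonneg _)
      (by positivity) c1 c2 cΘ hM hTΘ
      (by
        intro t ht L hL
        rw [integral_add (Bx_int L (by fun_prop)) (Bx_int L (by fun_prop)),
          integral_add (Bx_int L (by fun_prop)) (Bx_int L (by fun_prop))]
        exact add_le_add (add_le_add
          (hB1 t ⟨ht.1, ht.2.trans k2'⟩ (ht.2.trans k1') L)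
          (hB2 t ⟨ht.1, ht.2.trans k3'⟩ (ht.2.trans k1') L))
          (hB3 t ⟨ht.1, ht.2.trans k4'⟩ (ht.2.trans k1') L))
      (by
        intro t ht B hB L hL
        have sl : ∀ {f : ℝ × ℝ × ℝ → ℝ}, Continuous f → Continuous (fun x => TI t0 f (t, x)) :=
          fun hf => (TI_cont t0 hf).comp (by fun_prop)
        exact energy_space (k0 := k0) (k1 := k1) hμ hg hk0 hk1
          (V1 := fun x => TI t0 v1 (t, x)) (V2 := fun x => TI t0 v2 (t, x))
          (V11 := fun x => TI t0 (sd1 v1) (t, x)) (V12 := fun x => TI t0 (sd2 v1) (t, x))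
          (V21 := fun x => TI t0 (sd1 v2) (t, x)) (V22 := fun x => TI t0 (sd2 v2) (t, x))
          (A111 := fun x => TI t0 (sd1 (sd1 v1)) (t, x))
          (A112 := fun x => TI t0 (sd2 (sd1 v1)) (t, x))
          (A121 := fun x => TI t0 (sd1 (sd2 v1)) (t, x))
          (A122 := fun x => TI t0 (sd2 (sd2 v1)) (t, x))
          (A211 := fun x => TI t0 (sd1 (sd1 v2)) (t, x))
          (A212 := fun x => TI t0 (sd2 (sd1 v2)) (t, x))
          (A221 := fun x => TI t0 (sd1 (sd2 v2)) (t, x))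
          (A222 := fun x => TI t0 (sd2 (sd2 v2)) (t, x))
          (P := fun x => TI t0 pr (t, x)) (P1 := fun x => TI t0 (sd1 pr) (t, x))
          (P2 := fun x => TI t0 (sd2 pr) (t, x)) (Q := fun x => TI t0 Θ (t, x))
          (a1 := fun x => v1 (t, x)) (a2 := fun x => v2 (t, x))
          (sl c1) (sl c2) (sl c11) (sl c12) (sl c21) (sl c22) (sl cx111) (sl cx122)
          (sl cx211) (sl cx222) (sl cp) (sl cp1) (sl cp2) (sl cΘ) (by fun_prop) (by fun_prop)
          (TI_PD t0 c1 c11 c12 P1 t) (TI_PD t0 c2 c21 c22 P2 t)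
          (TI_PD t0 c11 cx111 cx112 P11 t) (TI_PD t0 c12 cx121 cx122 P12 t)
          (TI_PD t0 c21 cx211 cx212 P21 t) (TI_PD t0 c22 cx221 cx222 P22 t)
          (TI_PD t0 cp cp1 cp2 Pp t)
          (fun x hx => by
            rw [← TI_add t0 c11 c22, ← TI_zero t0 (t, x)]
            exact TI_congr ht.1 fun r hr => hdiv (r, x) ⟨hI t ht r hr, hx⟩)
          (fun x => by
            refine Eq.trans ?_ (TI_zero t0 (t, (x, (0 : ℝ))))
            exact TI_congr ht.1 fun r hr => (hbc r (hI t ht r hr) x).1)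
          (fun x => by
            refine Eq.trans ?_ (TI_zero t0 (t, (x, (0 : ℝ))))
            exact TI_congr ht.1 fun r hr => (hbc r (hI t ht r hr) x).2.1)
          (fun x => by
            rw [← TI_cmul]
            exact TI_congr ht.1 fun r hr => (hbc r (hI t ht r hr) x).2.2.1)
          (fun x => by
            rw [← TI_cmul]
            exact TI_congr ht.1 fun r hr => (hbc r (hI t ht r hr) x).2.2.2)
          (fun x hx => by
            rw [← TI_td hv1 (z1 x hx) t, ← TI_add t0 cx111 cx122, ← TI_cmul,
              ← TI_sub t0 (by fun_prop) cp1]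
            refine TI_congr ht.1 fun r hr => ?_
            have := hmom1 (r, x) ⟨hI t ht r hr, hx⟩
            linarith)
          (fun x hx => by
            rw [← TI_td hv2 (z2 x hx) t, ← TI_add t0 cx211 cx222, ← TI_cmul t0 μ, ← TI_cmul t0 g,
              ← TI_sub t0 (by fun_prop) cp2, ← TI_add t0 (by fun_prop) (by fun_prop)]
            refine TI_congr ht.1 fun r hr => ?_
            have := hmom2 (r, x) ⟨hI t ht r hr, hx⟩
            linarith)
          B hB L hL)
    have hdz : ∀ (f : ℝ × ℝ × ℝ → ℝ), Continuous f → ∀ x,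
        (∀ t ∈ Icc t0 t1, TI t0 f (t, x) = 0) → ∀ t ∈ Ioo t0 t1, f (t, x) = 0 := by
      intro f hf x h t ht
      have e : (fun r => TI t0 f (r, x)) =ᶠ[𝓝 t] fun _ => 0 := by
        filter_upwards [Ioo_mem_nhds ht.1 ht.2] with r hr
        exact h r ⟨hr.1.le, hr.2.le⟩
      exact ((TI_dt t0 hf t x).congr_of_eventuallyEq e.symm).unique (hasDerivAt_const t (0 : ℝ))
    refine mem_of_superset (Ioo_mem_nhdsGT ht01) ?_
    intro t ht x hx
    refine ⟨hdz v1 c1 x (fun r hr => (hz r hr x hx).1) t ht,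
      hdz v2 c2 x (fun r hr => (hz r hr x hx).2) t ht, ?_⟩
    rw [hTΘ t ⟨ht.1.le, ht.2.le⟩ x hx, (hz t ⟨ht.1.le, ht.2.le⟩ x hx).2]
    simp
  rintro ⟨t, x⟩ ⟨ht, hx⟩
  exact hmain ht x hx
end
end
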